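/- Let t = 2t'+1 be an odd positive integer. For any complex numbers y and z, the following identity of formal power series in x and y holds: Σ_{λ ∈ SC} δ_λ x^{|λ|} ∏_{h ∈ H_t(λ)} (y - yzt/(h ε_h)) = ∏_{k≥1} [(1-x^{2kt})^{t'}/(1+x^k)] · [(1-x^{2kt})/(1-x^{kt})] · [(1-y^{2k}x^{2kt})^{(tz^2+z-t-1)/2}/(1-y^k x^{kt})^{z-1}], where the sum ranges over all self-conjugate partitions λ. -/

import Mathlib

/-!
Statement 3 (Theorem `genscpair`, odd case): for `t = 2t'+1` an odd positive
integer and complex numbers `y`, `z`,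
Σ_{λ ∈ SC} δ_λ x^{|λ|} ∏_{h ∈ H_t(λ)} (y - yzt/(h ε_h))
  = ∏_{k≥1} [(1-x^{2kt})^{t'}/(1+x^k)] · [(1-x^{2kt})/(1-x^{kt})]
      · [(1-y^{2k}x^{2kt})^{(tz²+z-t-1)/2}/(1-y^k x^{kt})^{z-1}],
where the sum ranges over self-conjugate partitions.
-/

noncomputable section

open PowerSeries

/-- Product (pi) topology on formal power series. -/
instance {R : Type*} [TopologicalSpace R] : TopologicalSpace (PowerSeries R) :=
  inferInstanceAs (TopologicalSpace ((Unit →₀ ℕ) → R))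

/-- The hook length of the box `c = (i, j)` (0-indexed) of a Young diagram. -/
def hookLen (μ : YoungDiagram) (c : ℕ × ℕ) : ℕ :=
  μ.rowLen c.1 + μ.colLen c.2 - c.1 - c.2 - 1

/-- The Durfee length: the number of diagonal cells. -/
def durfee (μ : YoungDiagram) : ℕ :=
  (μ.cells.filter fun c => c.1 = c.2).card

/-- `ε` of a box: `-1` if strictly above the principal diagonal, `1` otherwise. -/
def eps (c : ℕ × ℕ) : ℂ := if c.2 < c.1 then (-1 : ℂ) else 1

/-- Generalized binomial coefficient `binom(z, k) = z(z-1)⋯(z-k+1)/k!`. -/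
def cchoose (z : ℂ) (k : ℕ) : ℂ := (∏ i ∈ Finset.range k, (z - i)) / (k.factorial : ℂ)

/-- The complex power `f^z = Σ_k binom(z,k) (f-1)^k` of a power series with
constant coefficient `1`. -/
def cpow (f : PowerSeries ℂ) (z : ℂ) : PowerSeries ℂ :=
  ∑' k : ℕ, PowerSeries.C (cchoose z k) * (f - 1) ^ k


/-- The entries of the matrix `Q`. -/
def Qf {S : Type*} [CommRing S] (η : ℤ → S) (d : ℕ → S) (k : ℤ) (l : ℕ) : S :=
  η (k - l) - η (-k - l - 1) + d l * (η (k + l + 1) - η (l - k))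

/-- The shifted entries. -/
def dQf {S : Type*} [CommRing S] (η : ℤ → S) (d : ℕ → S) (m : ℕ) (k : ℤ) (l : ℕ) : S :=
  Qf (fun n => η (n - m)) d k l

/-- The matrix `Q`. -/
def Qm {S : Type*} [CommRing S] (η : ℤ → S) (d : ℕ → S) (N : ℕ) : Matrix (Fin N) (Fin N) S :=
  Matrix.of fun k l => Qf η d (k : ℕ) l

lemma Qf_odd {S : Type*} [CommRing S] (η : ℤ → S) (d : ℕ → S) (k : ℤ) (l : ℕ) :
    Qf η d (-1 - k) l = - Qf η d k l := by
  unfold Qf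
  have e1 : (-1 - k - l : ℤ) = -k - l - 1 := by ring
  have e2 : (-(-1 - k) - l - 1 : ℤ) = k - l := by ring
  have e3 : (-1 - k + l + 1 : ℤ) = l - k := by ring
  have e4 : (l - (-1 - k) : ℤ) = k + l + 1 := by ring
  rw [e1, e2, e3, e4]; ring

lemma Qf_shift {S : Type*} [CommRing S] (η : ℤ → S) (d : ℕ → S) (ξ : S) (m : ℕ)
    (hd : ∀ l, d (l + m) = ξ * d l) (hd2 : ∀ l, l < m → d l * d (m - 1 - l) = ξ) (k : ℤ) (l : ℕ) :
    (1 - ξ) * dQf η d m k l =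
      Qf η d k (l + m) + (if m ≤ l then ξ * Qf η d k (l - m) else d l * Qf η d k (m - 1 - l))
      - ξ * Qf η d (k + m) l - ξ * Qf η d (k - m) l := by
  have key : (if m ≤ l then ξ * Qf η d k (l - m) else d l * Qf η d k (m - 1 - l)) =
      ξ * (η (k - l + m) - η (-k - l + m - 1)) + d l * (η (k + l - m + 1) - η (l - m - k)) := by
    split_ifs with h
    · obtain ⟨l, rfl⟩ := Nat.exists_eq_add_of_le' h
      rw [hd]
      unfold Qf
      simp only [Nat.add_sub_cancel]
      push_cast
      have e1 : (k - (l + m) + m : ℤ) = k - l := by ring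
      have e2 : (-k - (l + m) + m - 1 : ℤ) = -k - l - 1 := by ring
      have e3 : (k + (l + m) - m + 1 : ℤ) = k + l + 1 := by ring
      have e4 : (l + m - m - k : ℤ) = l - k := by ring
      rw [e1, e2, e3, e4]; ring
    · push Not at h
      rw [← hd2 l h]
      unfold Qf
      have e : ((m - 1 - l : ℕ) : ℤ) = m - 1 - l := by omega
      rw [e]
      have e1 : (k - (m - 1 - l) : ℤ) = k + l - m + 1 := by ring
      have e2 : (-k - (m - 1 - l) - 1 : ℤ) = l - m - k := by ring
      have e3 : (k + (m - 1 - l) + 1 : ℤ) = k - l + m := by ring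
      have e4 : (m - 1 - l - k : ℤ) = -k - l + m - 1 := by ring
      rw [e1, e2, e3, e4]; ring
  rw [key]
  unfold dQf Qf
  rw [hd]
  push_cast
  have e1 : (k - (l + m) : ℤ) = k - l - m := by ring
  have e2 : (-k - (l + m) - 1 : ℤ) = -k - l - 1 - m := by ring
  have e3 : (k + (l + m) + 1 : ℤ) = k + m + l + 1 := by ring
  have e4 : (l + m - k : ℤ) = l - (k - m) := by ring
  have e5 : (k + m - l : ℤ) = k - l + m := by ring
  have e6 : (-(k + m) - l - 1 : ℤ) = -k - l - 1 - m := by ring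
  have e7 : (l - (k + m) : ℤ) = l - k - m := by ring
  have e8 : (k - m - l : ℤ) = k - l - m := by ring
  have e9 : (-(k - m) - l - 1 : ℤ) = -k - l + m - 1 := by ring
  have e10 : (k - m + l + 1 : ℤ) = k + l + 1 - m := by ring
  have e11 : (k + l - m + 1 : ℤ) = k + l + 1 - m := by ring
  have e12 : (l - m - k : ℤ) = l - k - m := by ring
  rw [e1, e2, e3, e4, e5, e6, e7, e8, e9, e10, e11, e12]; ring

section trace
variable {S : Type*} [CommRing S] (η γ : ℤ → S) (d : ℕ → S)

/-- the convolution inverse hypothesis -/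
structure ConvInv (η γ : ℤ → S) : Prop where
  η_neg : ∀ n, n < 0 → η n = 0
  γ_neg : ∀ n, n < 0 → γ n = 0
  conv : ∀ (i k N : ℕ), i < N → k < N →
    ∑ l ∈ Finset.range N, η (i - l) * γ (l - k) = if i = k then 1 else 0
  conv' : ∀ (i k N : ℕ), i < N → k < N →
    ∑ l ∈ Finset.range N, γ (i - l) * η (l - k) = if i = k then 1 else 0

variable {η γ d}

lemma adj_mul_col (N : ℕ) (l c : Fin N) :
    ∑ k : Fin N, (Qm η d N).adjugate l k * Qf η d (k : ℕ) c
      = if l = c then (Qm η d N).det else 0 := by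
  have := congrFun (congrFun (Matrix.adjugate_mul (Qm η d N)) l) c
  rw [Matrix.mul_apply] at this
  simpa [Matrix.one_apply, Qm] using this

lemma row_mul_adj (N : ℕ) (c k : Fin N) :
    ∑ l : Fin N, (Qm η d N).adjugate l k * Qf η d (c : ℕ) l
      = if c = k then (Qm η d N).det else 0 := by
  have := congrFun (congrFun (Matrix.mul_adjugate (Qm η d N)) c) k
  rw [Matrix.mul_apply] at this
  simp only [mul_comm ((Qm η d N).adjugate _ _)]
  simpa [Matrix.one_apply, Qm] using this

lemma adj_last (h : ConvInv η γ) (N n : ℕ) (hd : ∀ l, n ≤ l → d l = 0) (l k : Fin N)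
    (hk : n ≤ (k : ℕ)) :
    (Qm η d N).adjugate l k = (Qm η d N).det * γ ((l : ℕ) - (k : ℕ)) := by
  have h1 : (Qm η d N).mulVec (fun l : Fin N => γ ((l : ℕ) - (k : ℕ))) = Pi.single k 1 := by
    ext i
    have : ∀ l : Fin N, Qf η d (i : ℕ) l * γ ((l : ℕ) - (k : ℕ)) =
        η ((i : ℕ) - (l : ℕ)) * γ ((l : ℕ) - (k : ℕ)) := by
      intro l
      by_cases hl : (k : ℕ) ≤ l
      · unfold Qf
        rw [hd l (hk.trans hl), h.η_neg (-(i : ℕ) - (l : ℕ) - 1) (by omega)]; ring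
      · rw [h.γ_neg _ (by omega)]; simp
    simp only [Matrix.mulVec, dotProduct, Qm, Matrix.of_apply, this]
    rw [Fin.sum_univ_eq_sum_range (fun l => η ((i : ℕ) - (l : ℕ)) * γ ((l : ℕ) - (k : ℕ))) N,
      h.conv i k N i.2 k.2]
    simp [Pi.single_apply, Fin.ext_iff]
  have h2 : (Qm η d N).adjugate.mulVec
      ((Qm η d N).mulVec (fun l : Fin N => γ ((l : ℕ) - (k : ℕ)))) l =
      (Qm η d N).det * γ ((l : ℕ) - (k : ℕ)) := by
    rw [Matrix.mulVec_mulVec, Matrix.adjugate_mul]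
    simp [Matrix.smul_mulVec]
  rw [h1] at h2
  rw [← h2]
  simp

lemma lam_sum (h : ConvInv η γ) (N m : ℕ) (hm : m ≤ N) :
    ∑ k : Fin N, (if (k : ℕ) + m < N then 0 else
      ∑ l : Fin N, γ ((l : ℕ) - (k : ℕ)) * η ((k : ℕ) + m - (l : ℕ))) =
    ∑ j ∈ Finset.range m, ((m : S) - j) * (γ j * η (m - j)) := by
  rw [Fin.sum_univ_eq_sum_range (fun k => if k + m < N then 0 else
      ∑ l : Fin N, γ ((l : ℕ) - (k : ℤ)) * η ((k : ℤ) + m - (l : ℕ))) N]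
  obtain ⟨n, rfl⟩ := Nat.exists_eq_add_of_le' hm
  rw [Finset.sum_range_add, Finset.sum_eq_zero, zero_add]
  swap
  · intro k hk
    rw [if_pos]; simp at hk; omega
  have : ∀ x ∈ Finset.range m, (if n + x + m < n + m then 0 else
      ∑ l : Fin (n + m), γ ((l : ℕ) - ((n + x : ℕ) : ℤ)) * η (((n + x : ℕ) : ℤ) + m - (l : ℕ)))
      = ∑ j ∈ Finset.range (m - x), γ j * η (m - j) := by
    intro x hx
    rw [if_neg (by omega)]
    rw [Fin.sum_univ_eq_sum_range
      (fun l => γ ((l : ℕ) - ((n + x : ℕ) : ℤ)) * η (((n + x : ℕ) : ℤ) + m - (l : ℕ))) (n + m)]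
    have e : n + m = (n + x) + (m - x) := by simp at hx; omega
    rw [e, Finset.sum_range_add, Finset.sum_eq_zero, zero_add]
    · refine Finset.sum_congr rfl fun j _ => ?_
      congr 2 <;> push_cast <;> ring
    · intro l hl
      simp at hl
      rw [h.γ_neg _ (by omega)]; simp
  rw [Finset.sum_congr rfl this, ← Finset.sum_range_reflect]
  have : ∀ m : ℕ, ∀ f : ℕ → S, ∑ j ∈ Finset.range m, ∑ i ∈ Finset.range (m - (m - 1 - j)), f i =
      ∑ j ∈ Finset.range m, ((m : S) - j) * f j := by
    intro m f
    have : ∀ j ∈ Finset.range m, ∑ i ∈ Finset.range (m - (m - 1 - j)), f i =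
        ∑ i ∈ Finset.range (j + 1), f i := by
      intro j hj
      simp at hj
      congr 2; omega
    rw [Finset.sum_congr rfl this]
    clear this
    induction m with
    | zero => simp
    | succ m ih =>
      rw [Finset.sum_range_succ, ih, Finset.sum_range_succ, Finset.sum_range_succ, ← add_assoc,
        ← Finset.sum_add_distrib]
      push_cast
      congr 1
      · exact Finset.sum_congr rfl fun _ _ => by ring
      · ring
  exact this m _

lemma trace_lemma (h : ConvInv η γ) (ξ : S) (N m : ℕ) (hm : 1 ≤ m) (hmN : m ≤ N)
    (hd : ∀ l, d (l + m) = ξ * d l) (hd2 : ∀ l, l < m → d l * d (m - 1 - l) = ξ)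
    (hd0 : ∀ l, N - m ≤ l → d l = 0) :
    (1 - ξ) * ∑ l : Fin N, ∑ k : Fin N, (Qm η d N).adjugate l k * dQf η d m (k : ℕ) l =
      (Qm η d N).det * ((∑ l ∈ Finset.range N, if 2 * l + 1 = m then d l + ξ else 0)
        - ξ * ∑ j ∈ Finset.range m, ((m : S) - j) * (γ j * η (m - j))) := by
  set a := (Qm η d N).adjugate with ha
  set D := (Qm η d N).det with hD
  have S1 : ∀ l : Fin N, ∑ k : Fin N, a l k * Qf η d (k : ℕ) (l + m) = 0 := by
    intro l
    by_cases hl : (l : ℕ) + m < N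
    · rw [adj_mul_col N l ⟨l + m, hl⟩, if_neg]
      simp [Fin.ext_iff]; omega
    · apply Finset.sum_eq_zero
      intro k _
      unfold Qf
      rw [hd, hd0 l (by omega), h.η_neg _ (by push_cast; omega),
        h.η_neg (-(k : ℕ) - (((l : ℕ) + m : ℕ) : ℤ) - 1) (by omega)]
      simp
  have S2 : ∀ l : Fin N, ∑ k : Fin N, a l k * (if m ≤ (l : ℕ) then ξ * Qf η d (k : ℕ) (l - m)
      else d l * Qf η d (k : ℕ) (m - 1 - l)) = if 2 * (l : ℕ) + 1 = m then D * d l else 0 := by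
    intro l
    by_cases hl : m ≤ (l : ℕ)
    · have := adj_mul_col (η := η) (d := d) N l ⟨l - m, by omega⟩
      rw [if_neg (by simp [Fin.ext_iff]; omega)] at this
      simp only [if_pos hl, mul_left_comm _ ξ]
      rw [← Finset.mul_sum, this, if_neg (by omega)]; simp
    · have := adj_mul_col (η := η) (d := d) N l ⟨m - 1 - l, by omega⟩
      simp only [if_neg hl, mul_left_comm _ (d l)]
      rw [← Finset.mul_sum, this]
      by_cases h2 : 2 * (l : ℕ) + 1 = m
      · rw [if_pos h2, if_pos (by simp [Fin.ext_iff]; omega), mul_comm]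
      · rw [if_neg h2, if_neg (by simp [Fin.ext_iff]; omega), mul_zero]
  have S3 : ∀ k : Fin N, ∑ l : Fin N, a l k * Qf η d ((k : ℕ) + m) l =
      D * (if (k : ℕ) + m < N then 0 else
      ∑ l : Fin N, γ ((l : ℕ) - (k : ℕ)) * η ((k : ℕ) + m - (l : ℕ))) := by
    intro k
    by_cases hk : (k : ℕ) + m < N
    · have := row_mul_adj (η := η) (d := d) N ⟨k + m, hk⟩ k
      rw [if_neg (by simp [Fin.ext_iff]; omega)] at this
      rw [if_pos hk]
      push_cast at this
      rw [this]; simp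
    · rw [if_neg hk, Finset.mul_sum]
      refine Finset.sum_congr rfl fun l _ => ?_
      rw [ha, adj_last h N (N - m) hd0 l k (by omega)]
      by_cases hl : (k : ℕ) ≤ l
      · unfold Qf
        rw [hd0 l (by omega), h.η_neg (-((k : ℕ) + m) - (l : ℕ) - 1) (by omega)]; ring
      · rw [h.γ_neg _ (by omega)]; simp
  have S4 : ∀ k : Fin N, ∑ l : Fin N, a l k * Qf η d ((k : ℕ) - m) l =
      if 2 * (k : ℕ) + 1 = m then - D else 0 := by
    intro k
    by_cases hk : m ≤ (k : ℕ)
    · have := row_mul_adj (η := η) (d := d) N ⟨k - m, by omega⟩ k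
      rw [if_neg (by simp [Fin.ext_iff]; omega)] at this
      rw [if_neg (by omega)]
      push_cast [Nat.cast_sub hk] at this
      exact this
    · have := row_mul_adj (η := η) (d := d) N ⟨m - 1 - k, by omega⟩ k
      have e : ((k : ℕ) - m : ℤ) = -1 - ((m - 1 - k : ℕ) : ℤ) := by omega
      simp only [e, Qf_odd, mul_neg, Finset.sum_neg_distrib]
      rw [this]
      by_cases h2 : 2 * (k : ℕ) + 1 = m
      · rw [if_pos h2, if_pos (by simp [Fin.ext_iff]; omega)]
      · rw [if_neg h2, if_neg (by simp [Fin.ext_iff]; omega), neg_zero]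
  have main : (1 - ξ) * ∑ l : Fin N, ∑ k : Fin N, a l k * dQf η d m (k : ℕ) l =
      (∑ l : Fin N, ∑ k : Fin N, a l k * Qf η d (k : ℕ) (l + m)) +
      (∑ l : Fin N, ∑ k : Fin N, a l k * (if m ≤ (l : ℕ) then ξ * Qf η d (k : ℕ) (l - m)
      else d l * Qf η d (k : ℕ) (m - 1 - l))) -
      ξ * (∑ k : Fin N, ∑ l : Fin N, a l k * Qf η d ((k : ℕ) + m) l) -
      ξ * (∑ k : Fin N, ∑ l : Fin N, a l k * Qf η d ((k : ℕ) - m) l) := by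
    rw [Finset.sum_comm (f := fun (k l : Fin N) => a l k * Qf η d ((k : ℕ) + m) l),
      Finset.sum_comm (f := fun (k l : Fin N) => a l k * Qf η d ((k : ℕ) - m) l)]
    simp only [Finset.mul_sum, ← Finset.sum_add_distrib, ← Finset.sum_sub_distrib]
    refine Finset.sum_congr rfl fun l _ => Finset.sum_congr rfl fun k _ => ?_
    rw [mul_left_comm, Qf_shift η d ξ m hd hd2]; ring
  rw [main]
  simp only [S1, S2, S3, S4]
  rw [← Finset.mul_sum, lam_sum h N m hmN,
    Fin.sum_univ_eq_sum_range (fun l => if 2 * l + 1 = m then D * d l else 0) N,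
    Fin.sum_univ_eq_sum_range (fun l => if 2 * l + 1 = m then - D else 0) N]
  have : ∑ l ∈ Finset.range N, (if 2 * l + 1 = m then d l + ξ else 0) =
      (∑ l ∈ Finset.range N, if 2 * l + 1 = m then d l else 0) +
      ∑ l ∈ Finset.range N, (if 2 * l + 1 = m then ξ else 0) := by
    rw [← Finset.sum_add_distrib]
    refine Finset.sum_congr rfl fun l _ => ?_
    split_ifs <;> simp
  rw [this]
  have e1 : ∑ i ∈ Finset.range N, (if 2 * i + 1 = m then - D else 0) * ξ =
      - (D * ∑ i ∈ Finset.range N, (if 2 * i + 1 = m then ξ else 0)) := by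
    rw [Finset.mul_sum, ← Finset.sum_neg_distrib]
    refine Finset.sum_congr rfl fun l _ => ?_
    split_ifs <;> simp
  have e2 : ∑ i ∈ Finset.range N, (if 2 * i + 1 = m then D * d i else 0) =
      D * ∑ i ∈ Finset.range N, (if 2 * i + 1 = m then d i else 0) := by
    rw [Finset.mul_sum]
    refine Finset.sum_congr rfl fun l _ => ?_
    split_ifs <;> simp
  rw [e2, mul_comm ξ (∑ i ∈ Finset.range N, _), Finset.sum_mul, e1]
  simp only [Finset.sum_const_zero, zero_add]
  ring

lemma trace_large (h : ConvInv η γ) (N m K : ℕ) (hK : 1 ≤ K) (hm : K ≤ m)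
    (hd0 : ∀ l, K ≤ 2 * l + 1 → d l = 0) :
    ∑ l : Fin N, ∑ k : Fin N, (Qm η d N).adjugate l k * dQf η d m (k : ℕ) l = 0 := by
  refine Finset.sum_eq_zero fun l _ => Finset.sum_eq_zero fun k _ => ?_
  by_cases hkl : (l : ℕ) < k ∧ K ≤ 2 * (k : ℕ) + 1
  · rw [adj_last h N k (fun i hi => hd0 i (by omega)) l k le_rfl, h.γ_neg _ (by omega)]; simp
  · have : dQf η d m (k : ℕ) l = 0 := by
      unfold dQf Qf
      dsimp only
      rw [h.η_neg ((k : ℕ) - (l : ℕ) - m) (by omega),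
        h.η_neg (-(k : ℕ) - (l : ℕ) - 1 - m) (by omega)]
      by_cases hl : K ≤ 2 * (l : ℕ) + 1
      · rw [hd0 _ hl]; simp
      · rw [h.η_neg ((k : ℕ) + (l : ℕ) + 1 - m) (by omega),
          h.η_neg ((l : ℕ) - (k : ℕ) - m) (by omega)]; simp
    rw [this, mul_zero]
end trace

/-- Coefficients of `(1 - u) ^ e`. -/
def bn {S : Type*} [CommRing S] [Algebra ℚ S] (e : S) : ℕ → S
  | 0 => 1
  | k + 1 => ((k + 1 : ℚ)⁻¹) • (((k : S) - e) * bn e k)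

section bn
variable {S : Type*} [CommRing S] [Algebra ℚ S]

lemma bn_zero (e : S) : bn e 0 = 1 := rfl

lemma natq_smul (k : ℕ) (a : S) : ((k : S) + 1) * (((k + 1 : ℚ)⁻¹) • a) = a := by
  rw [mul_smul_comm]
  have : ((k : S) + 1) = algebraMap ℚ S (k + 1) := by simp
  rw [this, ← Algebra.smul_def, smul_smul, inv_mul_cancel₀ (by positivity), one_smul]

lemma nat_cancel (k : ℕ) {a b : S} (h : ((k : S) + 1) * a = ((k : S) + 1) * b) : a = b := by
  have h2 : ((k + 1 : ℚ)⁻¹) • (((k : S) + 1) * a) = ((k + 1 : ℚ)⁻¹) • (((k : S) + 1) * b) := by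
    rw [h]
  rwa [← mul_smul_comm, natq_smul, ← mul_smul_comm, natq_smul] at h2

lemma bn_succ (e : S) (k : ℕ) : ((k : S) + 1) * bn e (k + 1) = ((k : S) - e) * bn e k := by
  rw [bn, natq_smul]

lemma bn_map {S' : Type*} [CommRing S'] [Algebra ℚ S'] (φ : S →+* S') (e : S) (k : ℕ) :
    φ (bn e k) = bn (φ e) k := by
  induction k with
  | zero => simp [bn]
  | succ k ih => rw [bn, bn, map_rat_smul]; simp [ih]

lemma bn_self_zero (k : ℕ) : bn (0 : S) k = if k = 0 then 1 else 0 := by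
  induction k with
  | zero => simp [bn]
  | succ k ih => rw [bn, ih]; by_cases h : k = 0 <;> simp [h]

lemma sum_antidiag_nat (a c : ℕ → S) (n : ℕ) :
    ∑ p ∈ Finset.HasAntidiagonal.antidiagonal (n + 1), ((p.1 : S) * a p.1) * c p.2 =
      ∑ p ∈ Finset.HasAntidiagonal.antidiagonal n, (((p.1 : S) + 1) * a (p.1 + 1)) * c p.2 := by
  rw [Finset.Nat.sum_antidiagonal_succ]; simp

lemma sum_antidiag_nat' (a c : ℕ → S) (n : ℕ) :
    ∑ p ∈ Finset.HasAntidiagonal.antidiagonal (n + 1), a p.1 * ((p.2 : S) * c p.2) =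
      ∑ p ∈ Finset.HasAntidiagonal.antidiagonal n, a p.1 * (((p.2 : S) + 1) * c (p.2 + 1)) := by
  rw [Finset.Nat.sum_antidiagonal_succ']; simp

lemma bn_add (e f : S) (n : ℕ) :
    ∑ p ∈ Finset.HasAntidiagonal.antidiagonal n, bn e p.1 * bn f p.2 = bn (e + f) n := by
  induction n with
  | zero => simp [bn]
  | succ n ih =>
    apply nat_cancel n
    rw [bn_succ, ← ih]
    have : ((n : S) + 1) * ∑ p ∈ Finset.HasAntidiagonal.antidiagonal (n + 1), bn e p.1 * bn f p.2 =
        ∑ p ∈ Finset.HasAntidiagonal.antidiagonal (n + 1), ((p.1 : S) * bn e p.1) * bn f p.2 +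
        ∑ p ∈ Finset.HasAntidiagonal.antidiagonal (n + 1), bn e p.1 * ((p.2 : S) * bn f p.2) := by
      rw [Finset.mul_sum, ← Finset.sum_add_distrib]
      refine Finset.sum_congr rfl fun p hp => ?_
      have : ((n : S) + 1) = p.1 + p.2 := by
        rw [Finset.HasAntidiagonal.mem_antidiagonal] at hp; exact_mod_cast congrArg (Nat.cast : ℕ → S) hp.symm
      rw [this]; ring
    rw [this, sum_antidiag_nat, sum_antidiag_nat', ← Finset.sum_add_distrib, Finset.mul_sum]
    refine Finset.sum_congr rfl fun p hp => ?_
    rw [bn_succ, bn_succ]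
    have : (n : S) = p.1 + p.2 := by
      rw [Finset.HasAntidiagonal.mem_antidiagonal] at hp; exact_mod_cast congrArg (Nat.cast : ℕ → S) hp.symm
    rw [this]; ring

lemma bn_conv_neg (e : S) (n : ℕ) :
    ∑ p ∈ Finset.HasAntidiagonal.antidiagonal n, bn e p.1 * bn (-e) p.2 = if n = 0 then 1 else 0 := by
  rw [bn_add, add_neg_cancel, bn_self_zero]

lemma bn_conv_weight (z : S) (n : ℕ) :
    ∑ p ∈ Finset.HasAntidiagonal.antidiagonal n, bn z p.1 * ((p.2 : S) * bn (-z) p.2) = if n = 0 then 0 else z := by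
  induction n with
  | zero => simp
  | succ n ih =>
    rw [sum_antidiag_nat']
    simp only [bn_succ]
    simp only [sub_neg_eq_add, add_mul, mul_add, Finset.sum_add_distrib]
    rw [ih]
    simp only [mul_left_comm _ z]
    rw [← Finset.mul_sum, bn_conv_neg]
    by_cases h : n = 0 <;> simp [h]

lemma bn_deriv {R : Type*} [CommRing R] [Algebra R S] (D : Derivation R S S) (e : S) (k : ℕ) :
    D (bn e k) = - D e * ∑ j ∈ Finset.range k, ((j + 1 : ℚ)⁻¹) • bn e (k - 1 - j) := by
  have key : ∀ k, D (bn e (k + 1)) = - D e * ∑ p ∈ Finset.HasAntidiagonal.antidiagonal k,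
      bn e p.1 * (((p.2 + 1 : ℚ)⁻¹) • (1 : S)) := by
    intro k
    induction k with
    | zero => simp [bn]
    | succ k ih =>
      apply nat_cancel (k + 1)
      have h1 : ((k + 1 : ℕ) + 1 : S) * D (bn e (k + 1 + 1)) =
          - D e * bn e (k + 1) + ((k + 1 : ℕ) - e) * D (bn e (k + 1)) := by
        have := congrArg D (bn_succ e (k + 1))
        rw [D.leibniz, D.leibniz] at this
        simp only [map_add, map_sub, Derivation.map_natCast, Derivation.map_one_eq_zero,
          smul_eq_mul] at this
        linear_combination this
      rw [h1, ih]
      have h2 : ((k + 1 : ℕ) + 1 : S) * ∑ p ∈ Finset.HasAntidiagonal.antidiagonal (k + 1),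
            bn e p.1 * (((p.2 + 1 : ℚ)⁻¹) • (1 : S)) =
          ∑ p ∈ Finset.HasAntidiagonal.antidiagonal (k + 1), ((p.1 : S) * bn e p.1) *
            (((p.2 + 1 : ℚ)⁻¹) • (1 : S)) +
          ∑ p ∈ Finset.HasAntidiagonal.antidiagonal (k + 1), bn e p.1 := by
        rw [Finset.mul_sum, ← Finset.sum_add_distrib]
        refine Finset.sum_congr rfl fun p hp => ?_
        have : ((k + 1 : ℕ) : S) = p.1 + p.2 := by
          rw [Finset.HasAntidiagonal.mem_antidiagonal] at hp
          exact_mod_cast congrArg (Nat.cast : ℕ → S) hp.symm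
        rw [this]
        have := natq_smul (S := S) p.2 1
        linear_combination (bn e p.1) * this
      rw [mul_left_comm _ (- D e), mul_left_comm _ (- D e), h2, sum_antidiag_nat (bn e) (fun j => ((j + 1 : ℚ)⁻¹) • (1 : S)),
        Finset.Nat.sum_antidiagonal_succ' (f := fun p => bn e p.1)]
      have h3 : ((k + 1 : ℕ) - e) * ∑ p ∈ Finset.HasAntidiagonal.antidiagonal k,
          bn e p.1 * (((p.2 + 1 : ℚ)⁻¹) • (1 : S)) =
          ∑ p ∈ Finset.HasAntidiagonal.antidiagonal k, (((p.1 : S) + 1) * bn e (p.1 + 1)) *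
            (((p.2 + 1 : ℚ)⁻¹) • (1 : S)) + ∑ p ∈ Finset.HasAntidiagonal.antidiagonal k, bn e p.1 := by
        rw [Finset.mul_sum, ← Finset.sum_add_distrib]
        refine Finset.sum_congr rfl fun p hp => ?_
        have : ((k + 1 : ℕ) : S) = p.1 + p.2 + 1 := by
          rw [Finset.HasAntidiagonal.mem_antidiagonal] at hp
          rw [← hp]; push_cast; ring
        rw [this, bn_succ]
        have := natq_smul (S := S) p.2 1
        linear_combination (bn e p.1) * this
      rw [h3]
      ring
  cases k with
  | zero => simp [bn]
  | succ k =>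
    rw [key, Finset.Nat.sum_antidiagonal_eq_sum_range_succ_mk, ← Finset.sum_range_reflect]
    congr 1
    refine Finset.sum_congr rfl fun j hj => ?_
    simp only [Finset.mem_range] at hj
    have e1 : k + 1 - 1 - j = k - j := by omega
    have e2 : k - (k - j) = j := by omega
    simp only [e1, Nat.succ_eq_add_one, e2]
    rw [mul_smul_comm, mul_one]
end bn

section sp
variable {S : Type*} [CommRing S]

/-- spread a sequence to multiples of `t` -/
def sp (t : ℕ) (a : ℕ → S) (n : ℤ) : S :=
  if 0 ≤ n ∧ (t : ℤ) ∣ n then a (n / t).toNat else 0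

lemma sp_neg (t : ℕ) (a : ℕ → S) (n : ℤ) (h : n < 0) : sp t a n = 0 := by
  unfold sp; rw [if_neg]; omega

lemma sp_nat (t : ℕ) (a : ℕ → S) (n : ℕ) : sp t a n = if t ∣ n then a (n / t) else 0 := by
  unfold sp
  have : (((n : ℤ) / t).toNat) = n / t := by
    rw [← Int.natCast_ediv, Int.toNat_natCast]
  rw [this]
  simp [Int.natCast_dvd_natCast]

lemma sum_dvd (t : ℕ) (ht : 0 < t) (F : ℕ → S) (n : ℕ) :
    ∑ j ∈ Finset.range (n + 1), (if t ∣ j then F (j / t) else 0) =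
      ∑ s ∈ Finset.range (n / t + 1), F s := by
  rw [← Finset.sum_filter]
  symm
  refine Finset.sum_bij (fun s _ => t * s) ?_ ?_ ?_ ?_
  · intro s hs
    simp only [Finset.mem_range, Finset.mem_filter] at hs ⊢
    refine ⟨?_, dvd_mul_right _ _⟩
    have : t * s ≤ t * (n / t) := Nat.mul_le_mul_left _ (by omega)
    have := Nat.mul_div_le n t
    omega
  · intro a _ b _ h
    exact Nat.eq_of_mul_eq_mul_left ht h
  · intro j hj
    simp only [Finset.mem_range, Finset.mem_filter] at hj ⊢
    refine ⟨j / t, ?_, Nat.mul_div_cancel' hj.2⟩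
    have := Nat.div_le_div_right (c := t) (show j ≤ n by omega)
    omega
  · intro s _
    rw [Nat.mul_div_cancel_left _ ht]

lemma sp_conv (t : ℕ) (ht : 0 < t) (a c : ℕ → S) (n : ℕ) :
    ∑ j ∈ Finset.range (n + 1), sp t c j * sp t a (n - j) =
      if t ∣ n then ∑ p ∈ Finset.HasAntidiagonal.antidiagonal (n / t), c p.1 * a p.2 else 0 := by
  have h1 : ∀ j ∈ Finset.range (n + 1), sp t c j * sp t a (n - j) =
      if t ∣ j then (if t ∣ n then c (j / t) * a (n / t - j / t) else 0) else 0 := by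
    intro j hj
    simp only [Finset.mem_range] at hj
    have : ((n : ℤ) - j) = ((n - j : ℕ) : ℤ) := by omega
    rw [this, sp_nat, sp_nat]
    by_cases h : t ∣ j
    · rw [if_pos h, if_pos h]
      obtain ⟨i, rfl⟩ := h
      by_cases h2 : t ∣ n
      · rw [if_pos h2]
        obtain ⟨k, rfl⟩ := h2
        rw [← Nat.mul_sub, if_pos (dvd_mul_right _ _), Nat.mul_div_cancel_left _ ht,
          Nat.mul_div_cancel_left _ ht, Nat.mul_div_cancel_left _ ht]
      · rw [if_neg h2, if_neg, mul_zero]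
        intro h3
        apply h2
        have := dvd_add h3 (dvd_mul_right t i)
        rwa [Nat.sub_add_cancel (by omega)] at this
    · simp [h]
  rw [Finset.sum_congr rfl h1, sum_dvd t ht (fun s => if t ∣ n then c s * a (n / t - s) else 0)]
  by_cases h : t ∣ n
  · simp only [if_pos h]
    rw [Finset.Nat.sum_antidiagonal_eq_sum_range_succ_mk]
  · simp [h]

lemma sp_convInv (t : ℕ) (ht : 0 < t) (a c : ℕ → S)
    (h : ∀ n, ∑ p ∈ Finset.HasAntidiagonal.antidiagonal n, c p.1 * a p.2 = if n = 0 then 1 else 0) :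
    ConvInv (sp t a) (sp t c) := by
  have gen : ∀ a c : ℕ → S,
    (∀ n, ∑ p ∈ Finset.HasAntidiagonal.antidiagonal n, c p.1 * a p.2 = if n = 0 then 1 else 0) →
    ∀ (i k N : ℕ), i < N → k < N →
    ∑ l ∈ Finset.range N, sp t a (i - l) * sp t c (l - k) = if i = k then 1 else 0 := by
    intro a c h i k N hi hk
    rw [← Finset.sum_subset (s₁ := Finset.range (i + 1)) (by intro x; simp; omega)]
    swap
    · intro l _ hl
      simp only [Finset.mem_range] at hl
      rw [sp_neg t a _ (by omega), zero_mul]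
    by_cases hik : i < k
    · rw [if_neg (by omega)]
      apply Finset.sum_eq_zero
      intro l hl
      simp only [Finset.mem_range] at hl
      rw [sp_neg t c _ (by omega), mul_zero]
    · obtain ⟨n, rfl⟩ := Nat.exists_eq_add_of_le (not_lt.mp hik)
      rw [add_assoc, Finset.sum_range_add, Finset.sum_eq_zero, zero_add]
      · have : ∀ x ∈ Finset.range (n + 1), sp t a (((k + n : ℕ) : ℤ) - ((k + x : ℕ) : ℤ)) *
            sp t c (((k + x : ℕ) : ℤ) - k) = sp t c x * sp t a (n - x) := by
          intro x _
          rw [mul_comm]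
          congr 2 <;> push_cast <;> ring
        rw [Finset.sum_congr rfl this, sp_conv t ht]
        by_cases h2 : t ∣ n
        · rw [if_pos h2, h]
          obtain ⟨k, rfl⟩ := h2
          rw [Nat.mul_div_cancel_left _ ht]
          have : t ≠ 0 := by omega
          simp [this]
        · rw [if_neg h2, if_neg]
          intro h3; apply h2
          have : n = 0 := by omega
          simp [this]
      · intro l hl
        simp only [Finset.mem_range] at hl
        rw [sp_neg t c _ (by omega), mul_zero]
  refine ⟨sp_neg t a, sp_neg t c, gen a c h, gen c a ?_⟩
  intro n
  rw [← h n, ← Finset.Nat.sum_antidiagonal_swap]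
  exact Finset.sum_congr rfl fun p _ => by simp [mul_comm]

variable [Algebra ℚ S]

lemma sp_lam (t : ℕ) (ht : 0 < t) (z : S) (m : ℕ) (hm : 0 < m) :
    ∑ j ∈ Finset.range m, ((m : S) - j) * (sp t (bn z) j * sp t (bn (-z)) (m - j)) =
      if t ∣ m then (t : S) * z else 0 := by
  have h1 : ∑ j ∈ Finset.range m, ((m : S) - j) * (sp t (bn z) j * sp t (bn (-z)) (m - j)) =
      ∑ j ∈ Finset.range (m + 1), ((m : S) - j) * (sp t (bn z) j * sp t (bn (-z)) (m - j)) := by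
    rw [Finset.sum_range_succ]; simp
  have h2 : ∀ j ∈ Finset.range (m + 1),
      ((m : S) - j) * (sp t (bn z) j * sp t (bn (-z)) (m - j)) =
      (t : S) * (sp t (bn z) j * sp t (fun k => (k : S) * bn (-z) k) (m - j)) := by
    intro j hj
    simp only [Finset.mem_range] at hj
    have : ((m : ℤ) - j) = ((m - j : ℕ) : ℤ) := by omega
    have e : (m : S) - j = ((m - j : ℕ) : S) := by
      rw [Nat.cast_sub (by omega)]
    rw [this, sp_nat t (bn (-z)), sp_nat t (fun k => (k : S) * bn (-z) k), e]
    by_cases h : t ∣ m - j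
    · rw [if_pos h, if_pos h]
      have : ((m - j : ℕ) : S) = t * ((m - j) / t : ℕ) := by
        rw [← Nat.cast_mul, Nat.mul_div_cancel' h]
      rw [this]; ring
    · simp [h]
  rw [h1, Finset.sum_congr rfl h2, ← Finset.mul_sum, sp_conv t ht]
  by_cases h : t ∣ m
  · rw [if_pos h, if_pos h, bn_conv_weight, if_neg]
    obtain ⟨k, rfl⟩ := h
    rw [Nat.mul_div_cancel_left _ ht]
    rintro rfl; simp at hm
  · simp [h]

lemma sp_deriv {R : Type*} [CommRing R] [Algebra R S] (D : Derivation R S S) (t : ℕ) (ht : 0 < t)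
    (z : S) (hz : D z = 1) (J : ℕ) (n : ℤ) (hn : n < t * (J + 1)) :
    D (sp t (bn (-z)) n) = ∑ j ∈ Finset.range J, ((j + 1 : ℚ)⁻¹) •
      sp t (bn (-z)) (n - (t * (j + 1) : ℕ)) := by
  by_cases h0 : n < 0
  · rw [sp_neg _ _ _ h0, map_zero]
    symm
    apply Finset.sum_eq_zero
    intro j _
    have : (0 : ℤ) ≤ (t * (j + 1) : ℕ) := by positivity
    rw [sp_neg _ _ _ (by linarith), smul_zero]
  · obtain ⟨n, rfl⟩ := Int.eq_ofNat_of_zero_le (not_lt.mp h0)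
    rw [sp_nat]
    by_cases h : t ∣ n
    · rw [if_pos h]
      obtain ⟨k, rfl⟩ := h
      rw [Nat.mul_div_cancel_left _ ht, bn_deriv]
      simp only [map_neg, hz, neg_neg, one_mul]
      have hk : k ≤ J := by
        have : t * k < t * (J + 1) := by exact_mod_cast hn
        have := Nat.lt_of_mul_lt_mul_left this
        omega
      rw [← Finset.sum_subset (s₁ := Finset.range k) (s₂ := Finset.range J)
        (by intro x; simp; omega)]
      · refine Finset.sum_congr rfl fun j hj => ?_
        simp only [Finset.mem_range] at hj
        have : (((t * k : ℕ) : ℤ) - (t * (j + 1) : ℕ)) = ((t * (k - 1 - j) : ℕ) : ℤ) := by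
          have : k = (k - 1 - j) + (j + 1) := by omega
          conv_lhs => rw [this]
          push_cast; ring
        rw [this, sp_nat, if_pos (dvd_mul_right _ _), Nat.mul_div_cancel_left _ ht]
      · intro j _ hj
        simp only [Finset.mem_range] at hj
        rw [sp_neg, smul_zero]
        have : t * k < t * (j + 1) := Nat.mul_lt_mul_of_pos_left (by omega) ht
        omega
    · rw [if_neg h, map_zero]
      symm
      apply Finset.sum_eq_zero
      intro j _
      unfold sp
      rw [if_neg, smul_zero]
      rintro ⟨_, h2⟩
      apply h
      have h3 : (t : ℤ) ∣ (t * (j + 1) : ℕ) := ⟨(j + 1), by push_cast; ring⟩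
      have := dvd_add h2 h3
      simp only [sub_add_cancel] at this
      exact Int.natCast_dvd_natCast.mp this
end sp

section deriv
variable {S : Type*} [CommRing S] {R : Type*} [CommRing R] [Algebra R S] (D : Derivation R S S)

lemma deriv_prod {ι : Type*} [DecidableEq ι] (s : Finset ι) (f : ι → S) :
    D (∏ i ∈ s, f i) = ∑ i ∈ s, (∏ j ∈ s.erase i, f j) * D (f i) := by
  induction s using Finset.induction_on with
  | empty => simp
  | insert a s ha ih =>
    rw [Finset.prod_insert ha, D.leibniz, ih, Finset.sum_insert ha, Finset.erase_insert ha]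
    simp only [smul_eq_mul]
    rw [add_comm, Finset.mul_sum]
    congr 1
    refine Finset.sum_congr rfl fun i hi => ?_
    rw [Finset.erase_insert_of_ne (by rintro rfl; exact ha hi),
      Finset.prod_insert (by simp [ha])]
    ring

lemma deriv_prod_log {ι : Type*} (s : Finset ι) (f c : ι → S)
    (h : ∀ i ∈ s, D (f i) = f i * c i) :
    D (∏ i ∈ s, f i) = (∏ i ∈ s, f i) * ∑ i ∈ s, c i := by
  classical
  rw [deriv_prod, Finset.mul_sum]
  refine Finset.sum_congr rfl fun i hi => ?_
  rw [h i hi, ← mul_assoc, Finset.prod_erase_mul _ _ hi]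

lemma deriv_det {n : Type*} [Fintype n] [DecidableEq n] (Q : Matrix n n S) :
    D Q.det = ∑ l, ∑ k, Q.adjugate l k * D (Q k l) := by
  have h1 : ∀ l, ∑ k, Q.adjugate l k * D (Q k l) = (Q.updateCol l (fun k => D (Q k l))).det := by
    intro l
    rw [← Matrix.cramer_apply, Matrix.cramer_eq_adjugate_mulVec]
    rfl
  simp only [h1]
  simp only [Matrix.det_apply', map_sum]
  rw [Finset.sum_comm]
  refine Finset.sum_congr rfl fun σ _ => ?_
  rw [D.leibniz, Derivation.map_intCast, smul_zero, add_zero, deriv_prod, smul_eq_mul,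
    Finset.mul_sum]
  refine Finset.sum_congr rfl fun l _ => ?_
  rw [← Finset.prod_erase_mul _ _ (Finset.mem_univ l)]
  congr 2
  · refine Finset.prod_congr rfl fun i hi => ?_
    rw [Matrix.updateCol_ne (Finset.ne_of_mem_erase hi)]
  · rw [Matrix.updateCol_self]
end deriv

section PP
variable {S : Type*} [CommRing S]

lemma trunc_mul (K : ℕ) (u : S) (hu : u ^ K = 0) (a c : ℕ → S) :
    (∑ k ∈ Finset.range K, a k * u ^ k) * (∑ k ∈ Finset.range K, c k * u ^ k) =
    ∑ n ∈ Finset.range K,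
      (∑ p ∈ Finset.HasAntidiagonal.antidiagonal n, a p.1 * c p.2) * u ^ n := by
  have hu' : ∀ n, K ≤ n → u ^ n = 0 := fun n hn => pow_eq_zero_of_le hn hu
  rw [Finset.sum_mul_sum, ← Finset.sum_product']
  have h1 : ∀ n ∈ Finset.range K,
      (∑ p ∈ Finset.HasAntidiagonal.antidiagonal n, a p.1 * c p.2) * u ^ n =
      ∑ p ∈ ((Finset.range K ×ˢ Finset.range K).filter (fun p => p.1 + p.2 < K)).filter
        (fun p => p.1 + p.2 = n), a p.1 * u ^ p.1 * (c p.2 * u ^ p.2) := by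
    intro n hn
    simp only [Finset.mem_range] at hn
    rw [Finset.sum_mul]
    refine Finset.sum_congr ?_ ?_
    · ext p
      simp only [Finset.HasAntidiagonal.mem_antidiagonal, Finset.mem_filter, Finset.mem_product,
        Finset.mem_range]
      omega
    · intro p hp
      simp only [Finset.mem_filter] at hp
      rw [← hp.2]; ring
  rw [Finset.sum_congr rfl h1, Finset.sum_fiberwise_of_maps_to
    (g := fun p : ℕ × ℕ => p.1 + p.2) (fun p hp => by simp at hp ⊢; exact hp.2)]
  symm
  apply Finset.sum_subset (Finset.filter_subset _ _)
  intro p hp hp2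
  have : K ≤ p.1 + p.2 := by
    by_contra h
    exact hp2 (Finset.mem_filter.mpr ⟨hp, not_le.mp h⟩)
  have := hu' _ this
  rw [pow_add] at this
  linear_combination (a p.1 * c p.2) * this

variable [Algebra ℚ S]

/-- truncated `(1 - u) ^ e` -/
def PP (K : ℕ) (e u : S) : S := ∑ k ∈ Finset.range K, bn e k * u ^ k

/-- truncated `- log (1 - u)` -/
def LL (K : ℕ) (u : S) : S := ∑ j ∈ Finset.range K, ((j + 1 : ℚ)⁻¹) • u ^ (j + 1)

lemma PP_mul (K : ℕ) (e f u : S) (hu : u ^ K = 0) : PP K e u * PP K f u = PP K (e + f) u := by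
  unfold PP
  rw [trunc_mul K u hu]
  simp only [bn_add]

lemma PP_zero (K : ℕ) (hK : 1 ≤ K) (u : S) : PP K 0 u = 1 := by
  unfold PP
  rw [Finset.sum_eq_single 0]
  · simp [bn_self_zero]
  · intro b _ hb
    simp [bn_self_zero, hb]
  · intro h
    simp at h
    omega

lemma PP_map {S' : Type*} [CommRing S'] [Algebra ℚ S'] (φ : S →+* S') (K : ℕ) (e u : S) :
    φ (PP K e u) = PP K (φ e) (φ u) := by
  unfold PP
  simp [map_sum, bn_map]

lemma PP_deriv {R : Type*} [CommRing R] [Algebra R S] (D : Derivation R S S) (K : ℕ) (e u : S)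
    (hu : u ^ K = 0) (hD : D u = 0) : D (PP K e u) = PP K e u * (- D e * LL K u) := by
  have h0 : LL K u = ∑ j ∈ Finset.range K,
      (if j = 0 then (0 : S) else ((j : ℚ)⁻¹) • 1) * u ^ j := by
    unfold LL
    cases K with
    | zero => simp
    | succ K =>
      rw [Finset.sum_range_succ, hu, smul_zero, add_zero, Finset.sum_range_succ']
      simp
  have h1 : PP K e u * LL K u = ∑ n ∈ Finset.range K,
      (∑ j ∈ Finset.range n, ((j + 1 : ℚ)⁻¹) • bn e (n - 1 - j)) * u ^ n := by
    rw [h0, PP, trunc_mul K u hu]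
    refine Finset.sum_congr rfl fun n _ => ?_
    congr 1
    cases n with
    | zero => simp
    | succ n =>
      rw [Finset.Nat.sum_antidiagonal_succ', Finset.Nat.sum_antidiagonal_eq_sum_range_succ_mk,
        ← Finset.sum_range_reflect]
      simp only [if_true, mul_zero, zero_add]
      refine Finset.sum_congr rfl fun j hj => ?_
      simp only [Finset.mem_range] at hj
      have e1 : n + 1 - 1 - j = n - j := by omega
      have e2 : n - (n - j) = j := by omega
      simp [e2]
  rw [mul_left_comm, h1, PP, map_sum, Finset.mul_sum]
  refine Finset.sum_congr rfl fun n _ => ?_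
  rw [D.leibniz, D.leibniz_pow, hD, bn_deriv]
  simp only [smul_eq_mul, mul_zero, smul_zero, zero_add]
  ring
end PP

section T
variable {S : Type*} [CommRing S]

lemma geo_inv (K : ℕ) (w : S) (hw : w ^ K = 0) : (1 - w) * ∑ i ∈ Finset.range K, w ^ i = 1 := by
  rw [mul_neg_geom_sum, hw, sub_zero]

lemma cancel_one_sub (K : ℕ) (w : S) (hw : w ^ K = 0) {a b : S}
    (h : (1 - w) * a = (1 - w) * b) : a = b := by
  have := geo_inv K w hw
  calc a = ((1 - w) * ∑ i ∈ Finset.range K, w ^ i) * a := by rw [this, one_mul]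
    _ = (∑ i ∈ Finset.range K, w ^ i) * ((1 - w) * a) := by ring
    _ = ((1 - w) * ∑ i ∈ Finset.range K, w ^ i) * b := by rw [h]; ring
    _ = b := by rw [this, one_mul]

/-- `∑_{k ≥ 1} w ^ k` truncated -/
def gs (K : ℕ) (w : S) : S := ∑ i ∈ Finset.range K, w ^ (i + 1)

lemma gs_zero (K : ℕ) : gs K (0 : S) = 0 := by simp [gs]

lemma one_sub_mul_gs (K : ℕ) (w : S) (hw : w ^ K = 0) : (1 - w) * gs K w = w := by
  have : gs K w = w * ∑ i ∈ Finset.range K, w ^ i := by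
    rw [gs, Finset.mul_sum]
    exact Finset.sum_congr rfl fun i _ => by ring
  rw [this, mul_left_comm, geo_inv K w hw, mul_one]

variable [Algebra ℚ S]

lemma sum_even_odd (f : ℕ → S) (N : ℕ) :
    ∑ j ∈ Finset.range (2 * N), f j =
      ∑ j ∈ Finset.range (2 * N), (if Odd j then 0 else f j) +
      ∑ i ∈ Finset.range N, f (2 * i + 1) := by
  induction N with
  | zero => simp
  | succ N ih =>
    rw [show 2 * (N + 1) = 2 * N + 1 + 1 by ring, Finset.sum_range_succ, Finset.sum_range_succ, ih,
      Finset.sum_range_succ, Finset.sum_range_succ, Finset.sum_range_succ]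
    have h1 : ¬ Odd (2 * N) := by simp
    have h2 : Odd (2 * N + 1) := ⟨N, rfl⟩
    rw [if_neg h1, if_pos h2]
    ring

/-- the logarithmic derivative -/
def TT (t K N : ℕ) (q z : S) : S :=
  ∑ j ∈ Finset.range (2 * N), ((j + 1 : ℚ)⁻¹) •
    ((if Odd j then 0 else gs K (q ^ (j + 1))) - (t : S) * z * gs K (q ^ (2 * (j + 1))))

lemma TT_eq (t K N : ℕ) (hN : K ≤ N) (q z : S) (hq : q ^ K = 0) :
    TT t K N q z = ∑ k ∈ Finset.range K,
      (LL K (q ^ (k + 1)) - ((t : S) * z + algebraMap ℚ S (1 / 2)) * LL K (q ^ (2 * (k + 1)))) := by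
  have hz : ∀ j, K ≤ j + 1 → gs K (q ^ (j + 1)) = 0 := by
    intro j hj
    rw [pow_eq_zero_of_le hj hq, gs_zero]
  have hz2 : ∀ j, K ≤ j + 1 → gs K (q ^ (2 * (j + 1))) = 0 := by
    intro j hj
    rw [pow_eq_zero_of_le (by omega) hq, gs_zero]
  have hL : ∑ k ∈ Finset.range K, LL K (q ^ (k + 1)) =
      ∑ j ∈ Finset.range (2 * N), ((j + 1 : ℚ)⁻¹) • gs K (q ^ (j + 1)) := by
    rw [← Finset.sum_subset (s₁ := Finset.range K) (s₂ := Finset.range (2 * N)) (by intro i; simp; omega)]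
    · unfold LL gs
      rw [Finset.sum_comm]
      refine Finset.sum_congr rfl fun j _ => ?_
      rw [Finset.smul_sum]
      refine Finset.sum_congr rfl fun i _ => ?_
      rw [← pow_mul, ← pow_mul, mul_comm]
    · intro j _ hj
      simp at hj
      rw [hz j (by omega), smul_zero]
  have hL2 : ∀ M, K ≤ M → ∑ k ∈ Finset.range K, LL K (q ^ (2 * (k + 1))) =
      ∑ j ∈ Finset.range M, ((j + 1 : ℚ)⁻¹) • gs K (q ^ (2 * (j + 1))) := by
    intro M hM
    rw [← Finset.sum_subset (s₁ := Finset.range K) (s₂ := Finset.range M) (by intro i; simp; omega)]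
    · unfold LL gs
      rw [Finset.sum_comm]
      refine Finset.sum_congr rfl fun j _ => ?_
      rw [Finset.smul_sum]
      refine Finset.sum_congr rfl fun i _ => ?_
      rw [← pow_mul, ← pow_mul]; congr 2; ring
    · intro j _ hj
      simp at hj
      rw [hz2 j (by omega), smul_zero]
  rw [Finset.sum_sub_distrib, ← Finset.mul_sum, add_mul, hL, sum_even_odd]
  nth_rw 1 [hL2 (2 * N) (by omega)]
  rw [hL2 N (by omega)]
  have e1 : TT t K N q z = ∑ j ∈ Finset.range (2 * N),
      (if Odd j then 0 else ((j + 1 : ℚ)⁻¹) • gs K (q ^ (j + 1))) -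
      t * z * ∑ j ∈ Finset.range (2 * N), ((j + 1 : ℚ)⁻¹) • gs K (q ^ (2 * (j + 1))) := by
    unfold TT
    rw [Finset.mul_sum, ← Finset.sum_sub_distrib]
    refine Finset.sum_congr rfl fun j _ => ?_
    rw [smul_sub, mul_smul_comm]
    split_ifs <;> simp
  have e2 : ∑ i ∈ Finset.range N, (((2 * i + 1 : ℕ) + 1 : ℚ)⁻¹) • gs K (q ^ (2 * i + 1 + 1)) =
      algebraMap ℚ S (1 / 2) *
        ∑ j ∈ Finset.range N, ((j + 1 : ℚ)⁻¹) • gs K (q ^ (2 * (j + 1))) := by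
    rw [Finset.mul_sum]
    refine Finset.sum_congr rfl fun j _ => ?_
    rw [← Algebra.smul_def, smul_smul]
    congr 1
    push_cast
    field_simp
    ring
  rw [e1, e2]
  ring
end T

section ode
variable {S : Type*} [CommRing S] [Algebra ℚ S] {R : Type*} [CommRing R] [Algebra R S]
  (D : Derivation R S S)

theorem det_ode (t' K N : ℕ) (hK : 1 ≤ K) (hN : 2 * K ≤ N) (x z : S) (hx : x ^ K = 0) (v : ℕ → S)
    (hDx : D x = 0) (hDz : D z = 1) (hDv : ∀ k, D (v k) = 0)
    (hv1 : ∀ l i, v (l + (2 * t' + 1) * i) = v l)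
    (hv2 : ∀ l l', (2 * t' + 1) ∣ l + l' + 1 → v l * v l' = 1)
    (hv3 : ∀ l, (2 * t' + 1) ∣ 2 * l + 1 → v l = 1) :
    D (Qm (sp (2 * t' + 1) (bn (-z))) (fun k => x ^ (2 * k + 1) * v k) N).det =
    (Qm (sp (2 * t' + 1) (bn (-z))) (fun k => x ^ (2 * k + 1) * v k) N).det *
      TT (2 * t' + 1) K N (x ^ (2 * t' + 1)) z := by
  set t := 2 * t' + 1 with ht
  set d : ℕ → S := fun k => x ^ (2 * k + 1) * v k with hd
  set η := sp t (bn (-z)) with hη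
  have hx' : ∀ n, K ≤ n → x ^ n = 0 := fun n hn => pow_eq_zero_of_le hn hx
  have hinv : ConvInv η (sp t (bn z)) := sp_convInv t (by omega) _ _ (bn_conv_neg z)
  have hd0 : ∀ l, K ≤ 2 * l + 1 → d l = 0 := fun l hl => by simp [hd, hx' _ hl]
  have tr : ∀ j, ∑ l : Fin N, ∑ k : Fin N,
      (Qm η d N).adjugate l k * dQf η d (t * (j + 1)) (k : ℕ) l =
      (Qm η d N).det * ((if Odd j then 0 else gs K ((x ^ t) ^ (j + 1))) -
        (t : S) * z * gs K ((x ^ t) ^ (2 * (j + 1)))) := by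
    intro j
    obtain ⟨m, hm⟩ : ∃ m, m = t * (j + 1) := ⟨_, rfl⟩
    have hm1 : j + 1 ≤ m := hm ▸ Nat.le_mul_of_pos_left _ (by omega)
    rw [← hm, ← pow_mul, ← pow_mul, ← hm, show t * (2 * (j + 1)) = 2 * m by rw [hm]; ring]
    by_cases hmK : K ≤ m
    · rw [trace_large hinv N m K hK hmK hd0, hx' m hmK, hx' (2 * m) (by omega), gs_zero]
      simp
    · push Not at hmK
      have hw : (x ^ m) ^ K = 0 := by rw [← pow_mul]; exact hx' _ (Nat.le_mul_of_pos_left _ (by omega))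
      have hw2 : (x ^ (2 * m)) ^ K = 0 := by
        rw [← pow_mul]; exact hx' _ (Nat.le_mul_of_pos_left _ (by omega))
      apply cancel_one_sub K (x ^ (2 * m)) hw2
      rw [trace_lemma hinv (x ^ (2 * m)) N m (by omega) (by omega)]
      · rw [mul_left_comm _ (Qm η d N).det]
        congr 1
        rw [sp_lam t (by omega) z m (by omega), if_pos ⟨j + 1, hm⟩]
        have hodd : ∑ l ∈ Finset.range N, (if 2 * l + 1 = m then d l + x ^ (2 * m) else 0) =
            if Odd j then 0 else x ^ m + x ^ (2 * m) := by
          by_cases hj : Odd j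
          · rw [if_pos hj]
            apply Finset.sum_eq_zero
            intro l _
            rw [if_neg]
            obtain ⟨i, rfl⟩ := hj
            rw [hm]
            intro h
            have : 2 * l + 1 = 2 * (t * (i + 1)) := by rw [h]; ring
            omega
          · rw [if_neg hj]
            have : Odd m := by
              rw [hm, Nat.odd_mul]
              refine ⟨⟨t', ht⟩, ?_⟩
              rw [Nat.not_odd_iff_even] at hj
              exact hj.add_one
            obtain ⟨l, hl⟩ := this
            rw [Finset.sum_eq_single l]
            · rw [if_pos hl.symm, hd]
              simp only
              rw [hv3 l ⟨j + 1, by rw [← hl, hm]⟩, ← hl, mul_one]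
            · intro b _ hb
              rw [if_neg (by omega)]
            · intro h
              simp at h
              omega
        rw [hodd, mul_sub, mul_left_comm _ ((t : S) * z), one_sub_mul_gs K _ hw2]
        have h3 : (1 - x ^ (2 * m)) * gs K (x ^ m) = x ^ m + x ^ (2 * m) := by
          have := one_sub_mul_gs K _ hw
          rw [show 2 * m = m + m by ring, pow_add]
          linear_combination (1 + x ^ m) * this
        by_cases hj : Odd j
        · simp only [if_pos hj]; ring
        · simp only [if_neg hj]; rw [h3]; ring
      · intro l
        simp only [hd]
        rw [hm, hv1]
        ring
      · intro l hl
        simp only [hd]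
        have h1 : v l * v (m - 1 - l) = 1 := hv2 _ _ ⟨j + 1, by omega⟩
        have h2 : x ^ (2 * l + 1) * x ^ (2 * (m - 1 - l) + 1) = x ^ (2 * m) := by
          rw [← pow_add]; congr 1; omega
        linear_combination (x ^ (2 * l + 1) * x ^ (2 * (m - 1 - l) + 1)) * h1 + h2
      · intro l hl
        exact hd0 l (by omega)
  have hDd : ∀ l, D (d l) = 0 := by
    intro l
    simp only [hd]
    rw [D.leibniz, hDv, D.leibniz_pow, hDx]; simp
  have hDQ : ∀ k l : Fin N, D (Qm η d N k l) =
      ∑ j ∈ Finset.range (2 * N), ((j + 1 : ℚ)⁻¹) • dQf η d (t * (j + 1)) (k : ℕ) l := by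
    intro k l
    have hb : ∀ n : ℤ, n < 2 * N → n < t * (((2 * N : ℕ) : ℤ) + 1) := by
      intro n hn
      have h1 : (1 : ℤ) ≤ t := by omega
      have : (0 : ℤ) ≤ 2 * N + 1 := by positivity
      push_cast
      nlinarith
    simp only [Qm, Matrix.of_apply, Qf, dQf]
    simp only [map_add, map_sub, D.leibniz, hDd, smul_eq_mul, mul_zero, add_zero, hη]
    rw [sp_deriv D t (by omega) z hDz (2 * N) _ (hb _ (by omega)),
      sp_deriv D t (by omega) z hDz (2 * N) _ (hb _ (by omega)),
      sp_deriv D t (by omega) z hDz (2 * N) _ (hb _ (by omega)),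
      sp_deriv D t (by omega) z hDz (2 * N) _ (hb _ (by omega))]
    simp only [← Finset.sum_sub_distrib, Finset.mul_sum, ← Finset.sum_add_distrib]
    refine Finset.sum_congr rfl fun j _ => ?_
    rw [smul_add, smul_sub, ← mul_smul_comm, smul_sub]
  rw [deriv_det]
  simp only [hDQ, Finset.mul_sum]
  unfold TT
  rw [Finset.mul_sum]
  have : ∀ l : Fin N, ∑ k : Fin N, ∑ j ∈ Finset.range (2 * N),
      (Qm η d N).adjugate l k * ((j + 1 : ℚ)⁻¹) • dQf η d (t * (j + 1)) (k : ℕ) l =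
      ∑ j ∈ Finset.range (2 * N), ∑ k : Fin N,
      (Qm η d N).adjugate l k * ((j + 1 : ℚ)⁻¹) • dQf η d (t * (j + 1)) (k : ℕ) l :=
    fun l => Finset.sum_comm
  simp only [this]
  rw [Finset.sum_comm]
  refine Finset.sum_congr rfl fun j _ => ?_
  simp only [mul_smul_comm, ← Finset.smul_sum]
  rw [tr]
end ode

section map
variable {S S' : Type*} [CommRing S] [CommRing S'] (φ : S →+* S')

lemma sp_map (t : ℕ) (a : ℕ → S) (n : ℤ) : φ (sp t a n) = sp t (fun k => φ (a k)) n := by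
  unfold sp; split_ifs <;> simp

lemma Qm_det_map (η : ℤ → S) (d : ℕ → S) (N : ℕ) :
    φ (Qm η d N).det = (Qm (fun n => φ (η n)) (fun n => φ (d n)) N).det := by
  rw [RingHom.map_det]
  congr 1
  ext k l
  simp [Qm, Qf]

lemma Qm_det_map_bn [Algebra ℚ S] [Algebra ℚ S'] (t : ℕ) (e : S) (d : ℕ → S) (N : ℕ) :
    φ (Qm (sp t (bn e)) d N).det = (Qm (sp t (bn (φ e))) (fun n => φ (d n)) N).det := by
  rw [Qm_det_map]
  congr 2
  ext n
  rw [sp_map]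
  simp only [bn_map]
end map

/-- the exponent -/
def Ez {S : Type*} [CommRing S] [Algebra ℚ S] (t : ℕ) (z : S) : S :=
  algebraMap ℚ S (1 / 2) * (t * z ^ 2 + z - t - 1)

lemma Ez_map {S S' : Type*} [CommRing S] [CommRing S'] [Algebra ℚ S] [Algebra ℚ S']
    (φ : S →+* S') (t : ℕ) (z : S) : φ (Ez t z) = Ez t (φ z) := by
  unfold Ez
  rw [map_mul, RingHom.map_rat_algebraMap]
  simp

/-- the product side -/
def RR {S : Type*} [CommRing S] [Algebra ℚ S] (K : ℕ) (e f q : S) : S :=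
  ∏ k ∈ Finset.range K, (PP K e (q ^ (2 * (k + 1))) * PP K f (q ^ (k + 1)))

lemma pow_mul_K {S : Type*} [CommRing S] (K : ℕ) (q : S) (hq : q ^ K = 0) (n : ℕ) (hn : 1 ≤ n) :
    (q ^ n) ^ K = 0 := by
  rw [← pow_mul]; exact pow_eq_zero_of_le (Nat.le_mul_of_pos_left _ hn) hq

lemma RR_mul_neg {S : Type*} [CommRing S] [Algebra ℚ S] (K : ℕ) (hK : 1 ≤ K) (e f q : S)
    (hq : q ^ K = 0) : RR K e f q * RR K (-e) (-f) q = 1 := by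
  unfold RR
  rw [← Finset.prod_mul_distrib]
  apply Finset.prod_eq_one
  intro k _
  rw [mul_mul_mul_comm, PP_mul K _ _ _ (pow_mul_K K q hq _ (by omega)),
    PP_mul K _ _ _ (pow_mul_K K q hq _ (by omega)), add_neg_cancel, add_neg_cancel,
    PP_zero K hK, PP_zero K hK, mul_one]

lemma RR_map {S S' : Type*} [CommRing S] [CommRing S'] [Algebra ℚ S] [Algebra ℚ S']
    (φ : S →+* S') (K : ℕ) (e f q : S) : φ (RR K e f q) = RR K (φ e) (φ f) (φ q) := by
  simp [RR, map_prod, PP_map]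

lemma RR_deriv {S : Type*} [CommRing S] [Algebra ℚ S] {R : Type*} [CommRing R] [Algebra R S]
    (D : Derivation R S S) (K t N : ℕ) (hN : K ≤ N) (q z : S) (hq : q ^ K = 0) (hDq : D q = 0)
    (hDz : D z = 1) :
    D (RR K (- Ez t z) (- (1 - z)) q) = RR K (- Ez t z) (- (1 - z)) q * (- TT t K N q z) := by
  have hE : D (Ez t z) = t * z + algebraMap ℚ S (1 / 2) := by
    unfold Ez
    rw [← Algebra.smul_def, map_rat_smul]
    simp only [map_sub, map_add, D.leibniz, D.leibniz_pow, hDz, Derivation.map_natCast,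
      Derivation.map_one_eq_zero, smul_zero, Algebra.smul_def, add_zero, sub_zero]
    have : algebraMap ℚ S (1 / 2) * 2 = 1 := by
      rw [show (2 : S) = algebraMap ℚ S 2 from (map_ofNat _ 2).symm, ← map_mul]; norm_num
    generalize algebraMap ℚ S (1 / 2) = h at *
    simp
    linear_combination (t * z) * this
  have hp : ∀ n, D (q ^ n) = 0 := by
    intro n; rw [D.leibniz_pow, hDq]; simp
  unfold RR
  rw [deriv_prod_log D _ _ (fun k => - (LL K (q ^ (k + 1)) -
    ((t : S) * z + algebraMap ℚ S (1 / 2)) * LL K (q ^ (2 * (k + 1)))))]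
  · rw [Finset.sum_neg_distrib, TT_eq t K N hN q z hq]
  · intro k _
    rw [D.leibniz, PP_deriv D K _ _ (pow_mul_K K q hq _ (by omega)) (hp _),
      PP_deriv D K _ _ (pow_mul_K K q hq _ (by omega)) (hp _)]
    simp only [map_neg, map_sub, hDz, hE, Derivation.map_one_eq_zero, smul_eq_mul]
    ring

theorem det_formula {B : Type*} [CommRing B] [Algebra ℚ B] (t' K N : ℕ) (hK : 1 ≤ K)
    (hN : 2 * K ≤ N) (x z : B) (hx : x ^ K = 0) (v : ℕ → B)
    (hv1 : ∀ l i, v (l + (2 * t' + 1) * i) = v l)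
    (hv2 : ∀ l l', (2 * t' + 1) ∣ l + l' + 1 → v l * v l' = 1)
    (hv3 : ∀ l, (2 * t' + 1) ∣ 2 * l + 1 → v l = 1) :
    (Qm (sp (2 * t' + 1) (bn (-z))) (fun k => x ^ (2 * k + 1) * v k) N).det =
    (Qm (sp (2 * t' + 1) (bn (-1))) (fun k => x ^ (2 * k + 1) * v k) N).det *
      RR K (Ez (2 * t' + 1) z) (1 - z) (x ^ (2 * t' + 1)) := by
  set t := 2 * t' + 1 with ht
  set D : Derivation B (Polynomial B) (Polynomial B) := Polynomial.derivative' with hD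
  set Z : Polynomial B := Polynomial.X with hZ
  set x' : Polynomial B := Polynomial.C x with hx'
  have hDC : ∀ b, D (Polynomial.C b) = 0 := fun b => Polynomial.derivation_C D b
  have hDZ : D Z = 1 := by
    show Polynomial.derivative Polynomial.X = 1
    exact Polynomial.derivative_X
  have hxK : x' ^ K = 0 := by rw [hx', ← Polynomial.C_pow, hx, Polynomial.C_0]
  have hqK : (x' ^ t) ^ K = 0 := pow_mul_K K x' hxK t (by omega)
  set f := (Qm (sp t (bn (-Z))) (fun k => x' ^ (2 * k + 1) * Polynomial.C (v k)) N).det with hf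
  have hode : D f = f * TT t K N (x' ^ t) Z := by
    apply det_ode D t' K N hK hN x' Z hxK (fun k => Polynomial.C (v k)) (hDC x) hDZ
      (fun k => hDC _)
    · intro l i; exact congrArg Polynomial.C (hv1 l i)
    · intro l l' h; show Polynomial.C (v l) * Polynomial.C (v l') = 1; rw [← Polynomial.C_mul, hv2 l l' h, Polynomial.C_1]
    · intro l h; show Polynomial.C (v l) = 1; rw [hv3 l h, Polynomial.C_1]
  set G := RR K (- Ez t Z) (- (1 - Z)) (x' ^ t) with hG
  have hGd : D G = G * (- TT t K N (x' ^ t) Z) := by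
    apply RR_deriv D K t N (by omega) _ _ hqK _ hDZ
    rw [D.leibniz_pow, hDC]; simp
  have hfG : D (f * G) = 0 := by
    rw [D.leibniz, hode, hGd]; simp only [smul_eq_mul]; ring
  have hconst : f * G = Polynomial.C ((f * G).coeff 0) := by
    ext n
    cases n with
    | zero => simp
    | succ n =>
      rw [Polynomial.coeff_C_succ]
      have : (Polynomial.derivative (f * G)).coeff n = 0 := by
        have : Polynomial.derivative (f * G) = D (f * G) := rfl
        rw [this, hfG]; simp
      rw [Polynomial.coeff_derivative] at this
      apply nat_cancel n
      rw [mul_comm, this, mul_zero]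
  have hev : ∀ w : B, Polynomial.eval w (f * G) = (f * G).coeff 0 := by
    intro w; conv_lhs => rw [hconst]
    simp
  have hevf : ∀ w : B, Polynomial.eval w f =
      (Qm (sp t (bn (-w))) (fun k => x ^ (2 * k + 1) * v k) N).det := by
    intro w
    rw [hf, ← Polynomial.coe_evalRingHom, Qm_det_map_bn]
    simp [hZ, hx']
  have hevG : ∀ w : B, Polynomial.eval w G = RR K (- Ez t w) (- (1 - w)) (x ^ t) := by
    intro w
    rw [hG, ← Polynomial.coe_evalRingHom, RR_map, map_neg, Ez_map]
    simp [hZ, hx']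
  have hqB : (x ^ t) ^ K = 0 := pow_mul_K K x hx t (by omega)
  have h1 : RR K (- Ez t (1 : B)) (- (1 - 1)) (x ^ t) = 1 := by
    have : Ez t (1 : B) = 0 := by unfold Ez; simp
    rw [this]
    simp [RR, PP_zero K hK]
  have e1 := (hev z).trans (hev 1).symm
  rw [Polynomial.eval_mul, Polynomial.eval_mul, hevf, hevf, hevG, hevG, h1, mul_one] at e1
  have e2 := RR_mul_neg K hK (Ez t z) (1 - z) (x ^ t) hqB
  rw [← e1, mul_assoc, mul_comm (RR K (- Ez t z) _ _), e2, mul_one]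

section minor
variable {S : Type*} [CommRing S]

/-- Principal minors. -/
def minor (K : ℕ → ℕ → S) (A : Finset ℕ) : S :=
  (Matrix.of fun (i j : A) => K i j).det

/-- The kernel. -/
def Kp (η γ : ℤ → S) (k l : ℕ) : S :=
  ∑ j ∈ Finset.range (k + 1), γ ((k : ℤ) - j) * (η ((l : ℤ) - j) - η ((j : ℤ) + l + 1))

lemma det_one_add_minors {n : Type*} [Fintype n] [DecidableEq n] (M : Matrix n n S) :
    (1 + M).det = ∑ s : Finset n, (M.submatrix (Subtype.val : s → n) Subtype.val).det := by
  rw [add_comm]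
  have := (Matrix.detRowAlternating (R := S) (n := n)).map_add_univ M.row (1 : Matrix n n S).row
  refine (Eq.trans ?_ this).trans ?_
  · rfl
  · apply Finset.sum_congr rfl
    intro s _
    exact Matrix.det_piecewise_one_eq_submatrix_det M s

lemma minor_smul (K : ℕ → ℕ → S) (d : ℕ → S) (A : Finset ℕ) :
    minor (fun k l => - (K k l * d l)) A = (-1) ^ A.card * (∏ k ∈ A, d k) * minor K A := by
  unfold minor
  have : (Matrix.of fun (i j : A) => - (K i j * d j)) =
      Matrix.of fun (i j : A) => (- d j) * (Matrix.of fun (i j : A) => K i j) i j := by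
    ext i j; simp [mul_comm]
  rw [this, Matrix.det_mul_row]
  congr 1
  rw [Finset.prod_coe_sort A (fun j => - d j), Finset.prod_neg]

lemma det_expand (K : ℕ → ℕ → S) (d : ℕ → S) (N : ℕ) :
    (1 + Matrix.of fun (k l : Fin N) => - (K k l * d l)).det =
      ∑ A ∈ (Finset.range N).powerset, (-1) ^ A.card * (∏ k ∈ A, d k) * minor K A := by
  rw [det_one_add_minors]
  refine Finset.sum_nbij (fun s => s.map Fin.valEmbedding) ?_ ?_ ?_ ?_
  · intro s _
    simp only [Finset.mem_powerset]
    intro x hx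
    simp only [Finset.mem_map, Fin.valEmbedding_apply] at hx
    obtain ⟨a, _, rfl⟩ := hx
    simp
  · intro a _ b _ h
    exact Finset.map_injective _ h
  · intro A hA
    simp only [Finset.coe_powerset, Set.mem_preimage, Set.mem_powerset_iff, Finset.coe_subset] at hA
    refine ⟨Finset.univ.filter (fun i : Fin N => (i : ℕ) ∈ A), by simp, ?_⟩
    ext x
    simp only [Finset.mem_map, Finset.mem_filter, Finset.mem_univ, true_and, Fin.valEmbedding_apply]
    constructor
    · rintro ⟨a, h, rfl⟩; exact h
    · intro h; exact ⟨⟨x, Finset.mem_range.1 (hA h)⟩, h, rfl⟩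
  · intro s _
    rw [← minor_smul]
    unfold minor
    rw [← Matrix.det_submatrix_equiv_self (s.equivMap Fin.valEmbedding)]
    rfl

lemma det_Q_expand (η γ : ℤ → S) (h : ConvInv η γ) (hγ : γ 0 = 1) (d : ℕ → S) (N : ℕ) :
    (Qm η d N).det =
      ∑ A ∈ (Finset.range N).powerset, (-1) ^ A.card * (∏ k ∈ A, d k) * minor (Kp η γ) A := by
  rw [← det_expand]
  have hG : (Matrix.of fun (k l : Fin N) => γ ((k : ℕ) - (l : ℕ) : ℤ)).det = 1 := by
    rw [Matrix.det_of_isLowerTriangular]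
    · simp [hγ]
    · intro i j hij
      apply h.γ_neg
      have : i < j := hij
      have : (i : ℕ) < j := this
      omega
  rw [← one_mul (Qm η d N).det, ← hG, ← Matrix.det_mul]
  congr 1
  ext k l
  rw [Matrix.mul_apply]
  have hk := k.2
  have hl := l.2
  simp only [Matrix.of_apply, Qm, Matrix.add_apply, Matrix.one_apply, Qf]
  rw [Fin.sum_univ_eq_sum_range (fun j => γ ((k : ℕ) - (j : ℕ) : ℤ) * (η ((j : ℕ) - (l : ℕ) : ℤ) - η (-(j : ℕ) - (l : ℕ) - 1 : ℤ) + d l * (η ((j : ℕ) + (l : ℕ) + 1 : ℤ) - η ((l : ℕ) - (j : ℕ) : ℤ))))]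
  have h1 : ∀ j ∈ Finset.range N, γ ((k : ℕ) - (j : ℕ) : ℤ) * (η ((j : ℕ) - (l : ℕ) : ℤ) - η (-(j : ℕ) - (l : ℕ) - 1 : ℤ) + d l * (η ((j : ℕ) + (l : ℕ) + 1 : ℤ) - η ((l : ℕ) - (j : ℕ) : ℤ))) = γ ((k : ℕ) - (j : ℕ) : ℤ) * η ((j : ℕ) - (l : ℕ) : ℤ) - (γ ((k : ℕ) - (j : ℕ) : ℤ) * (η ((l : ℕ) - (j : ℕ) : ℤ) - η ((j : ℕ) + (l : ℕ) + 1 : ℤ))) * d l := by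
    intro j _
    rw [h.η_neg (-(j : ℕ) - (l : ℕ) - 1 : ℤ) (by omega)]; ring
  rw [Finset.sum_congr rfl h1, Finset.sum_sub_distrib, h.conv' _ _ _ hk hl, ← Finset.sum_mul,
    sub_eq_add_neg]
  congr 1
  · simp [Fin.ext_iff]
  · congr 2
    unfold Kp
    symm
    apply Finset.sum_subset
    · intro x; simp; omega
    · intro x _ hx
      simp only [Finset.mem_range, not_lt] at hx
      rw [h.γ_neg _ (by omega), zero_mul]

end minor

lemma mod_dvd_sub (t k l : ℕ) (h : (t : ℤ) ∣ (k : ℤ) - l) : k % t = l % t := by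
  have := (Int.emod_emod_of_dvd k (dvd_refl (t : ℤ)))
  have h2 : (l : ℤ) ≡ k [ZMOD t] := Int.modEq_iff_dvd.2 h
  have h3 : l ≡ k [MOD t] := Int.natCast_modEq_iff.1 h2
  exact h3.symm

lemma dvd_sub_iff_mod (t k l : ℕ) : (t : ℤ) ∣ (k : ℤ) - l ↔ k % t = l % t := by
  refine ⟨mod_dvd_sub t k l, fun h => ?_⟩
  exact Int.modEq_iff_dvd.1 (Int.natCast_modEq_iff.2 (show l ≡ k [MOD t] from h.symm))

lemma dvd_add_iff_mod (t : ℕ) (ht : 0 < t) (k l : ℕ) :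
    t ∣ k + l + 1 ↔ k % t + l % t + 1 = t := by
  have hk := Nat.div_add_mod k t
  have hl := Nat.div_add_mod l t
  have h1 := Nat.mod_lt k ht
  have h2 := Nat.mod_lt l ht
  have e : k + l + 1 = t * (k / t + l / t) + (k % t + l % t + 1) := by
    rw [mul_add]; omega
  rw [e, Nat.dvd_add_right (dvd_mul_right _ _)]
  constructor
  · rintro ⟨c, hc⟩
    have : c = 1 := by
      rcases c with _ | _ | c
      · omega
      · rfl
      · exfalso; have : t * (c + 1 + 1) = t * c + t + t := by ring
        have : 0 ≤ t * c := Nat.zero_le _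
        omega
    rw [hc, this, mul_one]
  · intro h; rw [h]

section red
variable {S : Type*} [CommRing S]

lemma sp_mul (t : ℕ) (ht : 0 < t) (a : ℕ → S) (m : ℤ) : sp t a (t * m) = sp 1 a m := by
  have : (0 : ℤ) < t := by exact_mod_cast ht
  unfold sp
  rw [Int.mul_ediv_cancel_left _ this.ne']
  simp [mul_nonneg_iff_of_pos_left this]

lemma sum_reflect' (f : ℕ → S) (k : ℕ) :
    ∑ j ∈ Finset.range (k + 1), f j = ∑ j ∈ Finset.range (k + 1), f (k - j) := by
  rw [← Finset.sum_range_reflect]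
  simp

lemma M_red (t : ℕ) (ht : 0 < t) (g h : ℕ → S) (k l : ℕ) :
    ∑ j ∈ Finset.range (k + 1), sp t g ((k : ℤ) - j) * sp t h ((l : ℤ) - j) =
      if k % t = l % t then
        ∑ m ∈ Finset.range (k / t + 1), g m * sp 1 h (((l / t : ℕ) : ℤ) - (k / t : ℕ) + m) else 0 := by
  rw [sum_reflect']
  have hk := Nat.div_add_mod k t
  have hl := Nat.div_add_mod l t
  have h1 : ∀ j ∈ Finset.range (k + 1),
      sp t g ((k : ℤ) - (k - j : ℕ)) * sp t h ((l : ℤ) - (k - j : ℕ)) =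
      if t ∣ j then (if k % t = l % t then g (j / t) *
        sp 1 h (((l / t : ℕ) : ℤ) - (k / t : ℕ) + (j / t : ℕ)) else 0) else 0 := by
    intro j hj
    simp only [Finset.mem_range] at hj
    have e1 : (k : ℤ) - (k - j : ℕ) = (j : ℕ) := by omega
    rw [e1, sp_nat]
    by_cases h : t ∣ j
    · rw [if_pos h, if_pos h]
      obtain ⟨i, rfl⟩ := h
      rw [Nat.mul_div_cancel_left _ ht]
      split_ifs with h2
      · congr 1
        rw [← sp_mul t ht]
        congr 1
        have e3 : ((k - t * i : ℕ) : ℤ) = k - t * i := by push_cast [Nat.cast_sub (show t * i ≤ k by omega)]; ring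
        rw [e3]
        have hk' : (k : ℤ) = t * (k / t : ℕ) + (k % t : ℕ) := by exact_mod_cast hk.symm
        have hl' : (l : ℤ) = t * (l / t : ℕ) + (l % t : ℕ) := by exact_mod_cast hl.symm
        rw [h2] at hk'
        linear_combination hl' - hk'
      · have : sp t h ((l : ℤ) - (k - t * i : ℕ)) = 0 := by
          unfold sp
          rw [if_neg]
          rintro ⟨_, h4⟩
          apply h2
          symm
          rw [← dvd_sub_iff_mod]
          have e3 : ((k - t * i : ℕ) : ℤ) = k - t * i := by push_cast [Nat.cast_sub (show t * i ≤ k by omega)]; ring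
          rw [e3] at h4
          have := dvd_sub h4 (dvd_mul_right (t : ℤ) i)
          have e : (l : ℤ) - (k - t * i) - t * i = l - k := by ring
          rwa [e] at this
        rw [this, mul_zero]
    · simp [h]
  rw [Finset.sum_congr rfl h1, sum_dvd t ht (fun s => if k % t = l % t then g s *
        sp 1 h (((l / t : ℕ) : ℤ) - (k / t : ℕ) + (s : ℕ)) else 0)]
  split_ifs <;> simp

lemma N_red (t : ℕ) (ht : 0 < t) (g h : ℕ → S) (k l : ℕ) :
    ∑ j ∈ Finset.range (k + 1), sp t g ((k : ℤ) - j) * sp t h ((j : ℤ) + l + 1) =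
      if t ∣ k + l + 1 then
        ∑ m ∈ Finset.range (k / t + 1), g m * sp 1 h (((l / t : ℕ) : ℤ) + (k / t : ℕ) + 1 - m) else 0 := by
  rw [sum_reflect']
  have hk := Nat.div_add_mod k t
  have hl := Nat.div_add_mod l t
  have h1 : ∀ j ∈ Finset.range (k + 1),
      sp t g ((k : ℤ) - (k - j : ℕ)) * sp t h (((k - j : ℕ) : ℤ) + l + 1) =
      if t ∣ j then (if t ∣ k + l + 1 then g (j / t) *
        sp 1 h (((l / t : ℕ) : ℤ) + (k / t : ℕ) + 1 - (j / t : ℕ)) else 0) else 0 := by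
    intro j hj
    simp only [Finset.mem_range] at hj
    have e1 : (k : ℤ) - (k - j : ℕ) = (j : ℕ) := by omega
    rw [e1, sp_nat]
    by_cases h : t ∣ j
    · rw [if_pos h, if_pos h]
      obtain ⟨i, rfl⟩ := h
      have e3 : ((k - t * i : ℕ) : ℤ) = k - t * i := by push_cast [Nat.cast_sub (show t * i ≤ k by omega)]; ring
      rw [Nat.mul_div_cancel_left _ ht]
      split_ifs with h2
      · congr 1
        rw [← sp_mul t ht]
        congr 1
        rw [e3]
        have hk' : (k : ℤ) = t * (k / t : ℕ) + (k % t : ℕ) := by exact_mod_cast hk.symm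
        have hl' : (l : ℤ) = t * (l / t : ℕ) + (l % t : ℕ) := by exact_mod_cast hl.symm
        rw [dvd_add_iff_mod t ht] at h2
        have h2' : ((k % t : ℕ) : ℤ) + (l % t : ℕ) + 1 = t := by exact_mod_cast h2
        linear_combination hl' + hk' + h2'
      · have : sp t h (((k - t * i : ℕ) : ℤ) + l + 1) = 0 := by
          unfold sp
          rw [if_neg]
          rintro ⟨_, h4⟩
          apply h2
          rw [e3] at h4
          have := dvd_add h4 (dvd_mul_right (t : ℤ) i)
          have e : (k : ℤ) - t * i + l + 1 + t * i = ((k + l + 1 : ℕ) : ℤ) := by push_cast; ring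
          rw [e] at this
          exact_mod_cast this
        rw [this, mul_zero]
    · simp [h]
  rw [Finset.sum_congr rfl h1, sum_dvd t ht (fun s => if t ∣ k + l + 1 then g s *
        sp 1 h (((l / t : ℕ) : ℤ) + (k / t : ℕ) + 1 - (s : ℕ)) else 0)]
  split_ifs <;> simp

end red

section closed
variable (z : ℂ)

lemma bn_succ' (e : ℂ) (k : ℕ) : bn e (k + 1) = (k - e) / (k + 1) * bn e k := by
  have h := bn_succ e k
  have : (k : ℂ) + 1 ≠ 0 := by exact_mod_cast Nat.succ_ne_zero k
  field_simp
  linear_combination h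

lemma bn_pos_eq (e : ℂ) (k : ℕ) : bn e (k + 1) = - e / (k + 1) * bn (e - 1) k := by
  induction k with
  | zero => rw [bn_succ']; simp [bn_zero]
  | succ k ih =>
    rw [bn_succ', ih, bn_succ' (e - 1)]
    have : (k : ℂ) + 1 ≠ 0 := by exact_mod_cast Nat.succ_ne_zero k
    have : (k : ℂ) + 1 + 1 ≠ 0 := by exact_mod_cast Nat.succ_ne_zero (k + 1)
    push_cast
    field_simp
    ring

lemma bn_shift (e : ℂ) (k : ℕ) : (k - e) * bn e k = - e * bn (e - 1) k := by
  rw [← bn_succ, bn_pos_eq]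
  have : (k : ℂ) + 1 ≠ 0 := by exact_mod_cast Nat.succ_ne_zero k
  field_simp

lemma sp1_nat (h : ℕ → ℂ) (n : ℕ) : sp 1 h n = h n := by rw [sp_nat]; simp

lemma N_closed (i j : ℕ) :
    ∑ m ∈ Finset.range (i + 1), bn z m * sp 1 (bn (-z)) ((j : ℤ) + i + 1 - m) =
      z * bn (z - 1) i * bn (-z - 1) j / (i + j + 1) := by
  induction i generalizing j with
  | zero =>
    have e : ((j : ℤ) + (0 : ℕ) + 1 - (0 : ℕ)) = ((j + 1 : ℕ) : ℤ) := by push_cast; ring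
    rw [zero_add, Finset.sum_range_one, e, sp1_nat, bn_pos_eq (-z) j]
    simp [bn_zero]
    ring
  | succ i ih =>
    rw [Finset.sum_range_succ]
    have e : ((j : ℤ) + (i + 1 : ℕ) + 1 - (i + 1 : ℕ)) = ((j + 1 : ℕ) : ℤ) := by push_cast; ring
    rw [e, sp1_nat]
    have h2 := ih (j + 1)
    have e2 : ∀ m : ℕ, (((j + 1 : ℕ) : ℤ) + i + 1 - m) = (j : ℤ) + (i + 1 : ℕ) + 1 - m := by
      intro m; push_cast; ring
    simp only [e2] at h2
    rw [h2, bn_pos_eq z i, bn_pos_eq (-z) j, bn_succ' (z - 1), bn_succ' (-z - 1)]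
    have : (i : ℂ) + 1 ≠ 0 := by exact_mod_cast Nat.succ_ne_zero i
    have : (j : ℂ) + 1 ≠ 0 := by exact_mod_cast Nat.succ_ne_zero j
    have : (i : ℂ) + 1 + j + 1 ≠ 0 := by exact_mod_cast Nat.succ_ne_zero (i + 1 + j)
    have : (i : ℂ) + (j + 1) + 1 ≠ 0 := by exact_mod_cast Nat.succ_ne_zero (i + (j + 1))
    push_cast
    field_simp
    ring

lemma M_closed (hz : ∀ n : ℤ, z ≠ n) (i j : ℕ) :
    ∑ m ∈ Finset.range (i + 1), bn z m * sp 1 (bn (-z)) ((j : ℤ) - i + m) =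
      - z * bn (z - 1) i * bn (-z - 1) j / (i - j - z) := by
  have hne : ∀ i j : ℕ, (i : ℂ) - j - z ≠ 0 := by
    intro i j h
    apply hz (i - j)
    push_cast
    linear_combination - h
  induction i generalizing j with
  | zero =>
    have e : ((j : ℤ) - (0 : ℕ) + (0 : ℕ)) = ((j : ℕ) : ℤ) := by push_cast; ring
    rw [zero_add, Finset.sum_range_one, e, sp1_nat, eq_div_iff (hne 0 j)]
    have := bn_shift (-z) j
    simp only [bn_zero, Nat.cast_zero]
    linear_combination - this
  | succ i ih =>
    rw [Finset.sum_range_succ]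
    rcases j with _ | j
    · have e : (((0 : ℕ) : ℤ) - (i + 1 : ℕ) + (i + 1 : ℕ)) = ((0 : ℕ) : ℤ) := by push_cast; ring
      rw [e, sp1_nat, Finset.sum_eq_zero, eq_div_iff (hne (i + 1) 0)]
      · have := bn_shift z (i + 1)
        simp only [bn_zero, Nat.cast_zero]
        linear_combination this
      · intro m hm
        simp only [Finset.mem_range] at hm
        rw [sp_neg _ _ _ (by omega), mul_zero]
    · have e : (((j + 1 : ℕ) : ℤ) - (i + 1 : ℕ) + (i + 1 : ℕ)) = ((j + 1 : ℕ) : ℤ) := by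
        push_cast; ring
      rw [e, sp1_nat]
      have h2 := ih j
      have e2 : ∀ m : ℕ, (((j + 1 : ℕ) : ℤ) - (i + 1 : ℕ) + m) = (j : ℤ) - i + m := by
        intro m; push_cast; ring
      simp only [e2]
      rw [h2, bn_pos_eq z i, bn_pos_eq (-z) j, bn_succ' (z - 1), bn_succ' (-z - 1)]
      have : (i : ℂ) + 1 ≠ 0 := by exact_mod_cast Nat.succ_ne_zero i
      have : (j : ℂ) + 1 ≠ 0 := by exact_mod_cast Nat.succ_ne_zero j
      have := hne i j
      have e3 : ((i + 1 : ℕ) : ℂ) - (j + 1 : ℕ) - z = i - j - z := by push_cast; ring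
      rw [e3]
      field_simp
      ring

lemma Kp_closed (hz : ∀ n : ℤ, z ≠ n) (t : ℕ) (ht : 0 < t) (k l : ℕ) :
    Kp (sp t (bn (-z))) (sp t (bn z)) k l =
      (if k % t = l % t then
        - z * bn (z - 1) (k / t) * bn (-z - 1) (l / t) / ((k / t : ℕ) - (l / t : ℕ) - z) else 0) -
      (if t ∣ k + l + 1 then
        z * bn (z - 1) (k / t) * bn (-z - 1) (l / t) / ((k / t : ℕ) + (l / t : ℕ) + 1) else 0) := by
  unfold Kp
  simp only [mul_sub]
  rw [Finset.sum_sub_distrib, M_red t ht, N_red t ht]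
  simp only [M_closed z hz, N_closed z]

end closed

lemma minor_insert {F : Type*} [Field F] (K : ℕ → ℕ → F) (A : Finset ℕ) (a : ℕ) (ha : a ∉ A)
    (hK : K a a ≠ 0) (u v : ℕ → F)
    (h : ∀ k ∈ A, ∀ l ∈ A, K k l - K k a * (K a a)⁻¹ * K a l = u k * (v l * K k l)) :
    minor K (insert a A) = K a a * (∏ k ∈ A, (u k * v k)) * minor K A := by
  unfold minor
  set e : (A ⊕ PUnit.{1}) ≃ (insert a A : Finset ℕ) :=
    (Equiv.optionEquivSumPUnit A).symm.trans (Finset.subtypeInsertEquivOption ha).symm with he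
  rw [← Matrix.det_submatrix_equiv_self e]
  have hb : (Matrix.of fun (i j : (insert a A : Finset ℕ)) => K i j).submatrix e e =
      Matrix.fromBlocks (Matrix.of fun (i j : A) => K i j)
        (Matrix.of fun (i : A) (_ : PUnit.{1}) => K i a)
        (Matrix.of fun (_ : PUnit.{1}) (j : A) => K a j)
        (Matrix.of fun (_ _ : PUnit.{1}) => K a a) := by
    ext (i | i) (j | j) <;> rfl
  rw [hb]
  letI : Invertible (Matrix.of fun (_ _ : PUnit.{1}) => K a a) :=
    ⟨Matrix.of fun (_ _ : PUnit.{1}) => (K a a)⁻¹, by ext; simp [Matrix.mul_apply, hK],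
      by ext; simp [Matrix.mul_apply, hK]⟩
  rw [Matrix.det_fromBlocks₂₂]
  have h2 : (Matrix.of fun (i j : A) => K i j) - (Matrix.of fun (i : A) (_ : PUnit.{1}) => K i a) *
      ⅟(Matrix.of fun (_ _ : PUnit.{1}) => K a a) *
      (Matrix.of fun (_ : PUnit.{1}) (j : A) => K a j) =
      Matrix.of fun (i j : A) => u i * (Matrix.of fun (i j : A) => v j *
        (Matrix.of fun (i j : A) => K i j) i j) i j := by
    ext i j
    have e1 : ⅟(Matrix.of fun (_ _ : PUnit.{1}) => K a a) =
      Matrix.of fun (_ _ : PUnit.{1}) => (K a a)⁻¹ := rfl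
    rw [e1]
    simp only [Matrix.sub_apply, Matrix.mul_apply, Matrix.of_apply, Finset.univ_unique,
      Finset.sum_singleton]
    exact h i i.2 j j.2
  rw [h2, Matrix.det_mul_column, Matrix.det_mul_row,
    Finset.prod_coe_sort A u, Finset.prod_coe_sort A v, Finset.prod_mul_distrib]
  simp [mul_assoc]

section weights

/-- the local factor -/
def Gf (z : ℂ) (t h : ℕ) : ℂ := 1 - (z * t / h) ^ 2

/-- local weight of an element `a` of `A` -/
def loc (z : ℂ) (t : ℕ) (A : Finset ℕ) (a : ℕ) : ℂ :=
  (if t ∣ 2 * a + 1 then 1 - z * t / (2 * a + 1 : ℕ) else 1) *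
  ∏ l ∈ Finset.range a, if l ∈ A then (if t ∣ a + l + 1 then Gf z t (a + l + 1) else 1)
    else (if t ∣ a - l then Gf z t (a - l) else 1)

/-- total weight -/
def WA (z : ℂ) (t : ℕ) (A : Finset ℕ) : ℂ := ∏ a ∈ A, loc z t A a

lemma loc_congr (z : ℂ) (t : ℕ) (A B : Finset ℕ) (a : ℕ) (h : ∀ l < a, (l ∈ A ↔ l ∈ B)) :
    loc z t A a = loc z t B a := by
  unfold loc
  congr 1
  apply Finset.prod_congr rfl
  intro l hl
  simp only [h l (Finset.mem_range.1 hl)]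

lemma WA_insert (z : ℂ) (t : ℕ) (A : Finset ℕ) (a : ℕ) (h : ∀ x ∈ A, x < a) :
    WA z t (insert a A) = loc z t A a * WA z t A := by
  unfold WA
  have ha : a ∉ A := fun h' => lt_irrefl _ (h a h')
  rw [Finset.prod_insert ha]
  congr 1
  · apply loc_congr
    intro l hl
    simp [hl.ne]
  · apply Finset.prod_congr rfl
    intro b hb
    apply loc_congr
    intro l hl
    have := h b hb
    simp [show l ≠ a by omega]

variable (z : ℂ) (t' : ℕ)

def sg (t : ℕ) (k : ℕ) : ℂ := (2 * k + 1) / (2 * t)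

def rh (k : ℕ) : ℂ := if k % (2 * t' + 1) < t' then sg (2 * t' + 1) k else
  if t' < k % (2 * t' + 1) then z - sg (2 * t' + 1) k else (sg (2 * t' + 1) k - z / 2) ^ 2

def ta (k : ℕ) : ℂ := if k % (2 * t' + 1) < t' then sg (2 * t' + 1) k + z else
  if t' < k % (2 * t' + 1) then - sg (2 * t' + 1) k else (sg (2 * t' + 1) k + z / 2) ^ 2

def al (k : ℕ) : ℂ := - z * bn (z - 1) (k / (2 * t' + 1)) *
  (if k % (2 * t' + 1) < t' then 1 else
  if t' < k % (2 * t' + 1) then - 1 else (2 * sg (2 * t' + 1) k - z))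

def cls (k l : ℕ) : Prop := k % (2 * t' + 1) = l % (2 * t' + 1) ∨
  k % (2 * t' + 1) + l % (2 * t' + 1) + 1 = 2 * t' + 1

instance (k l : ℕ) : Decidable (cls t' k l) := by unfold cls; infer_instance

lemma sg_sub (t : ℕ) (ht : 0 < t) (k l : ℕ) (h : k % t = l % t) :
    ((k / t : ℕ) : ℂ) - (l / t : ℕ) = sg t k - sg t l := by
  have hk : (k : ℂ) = t * (k / t : ℕ) + (k % t : ℕ) := by exact_mod_cast (Nat.div_add_mod k t).symm
  have hl : (l : ℂ) = t * (l / t : ℕ) + (l % t : ℕ) := by exact_mod_cast (Nat.div_add_mod l t).symm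
  have h0 : (t : ℂ) ≠ 0 := by exact_mod_cast ht.ne'
  unfold sg
  rw [h] at hk
  field_simp
  linear_combination 2 * (hl - hk)

lemma sg_add (t : ℕ) (ht : 0 < t) (k l : ℕ) (h : k % t + l % t + 1 = t) :
    ((k / t : ℕ) : ℂ) + (l / t : ℕ) + 1 = sg t k + sg t l := by
  have hk : (k : ℂ) = t * (k / t : ℕ) + (k % t : ℕ) := by exact_mod_cast (Nat.div_add_mod k t).symm
  have hl : (l : ℂ) = t * (l / t : ℕ) + (l % t : ℕ) := by exact_mod_cast (Nat.div_add_mod l t).symm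
  have h0 : (t : ℂ) ≠ 0 := by exact_mod_cast ht.ne'
  have h' : ((k % t : ℕ) : ℂ) + (l % t : ℕ) + 1 = t := by exact_mod_cast h
  unfold sg
  field_simp
  linear_combination - 2 * hl - 2 * hk - 2 * h'

lemma sub_ne (hz : ∀ n : ℤ, z ≠ n) (t : ℕ) (ht : 0 < t) (k l : ℕ) (h : k % t = l % t) :
    sg t k - sg t l - z ≠ 0 := by
  rw [← sg_sub t ht k l h]
  intro h'
  apply hz (((k / t : ℕ) : ℤ) - ((l / t : ℕ) : ℤ))
  rw [Int.cast_sub, Int.cast_natCast, Int.cast_natCast]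
  linear_combination - h'

lemma add_ne (t : ℕ) (ht : 0 < t) (k l : ℕ) : sg t k + sg t l ≠ 0 := by
  have h0 : (t : ℂ) ≠ 0 := by exact_mod_cast ht.ne'
  unfold sg
  rw [← add_div]
  apply div_ne_zero
  · have : ((2 * k + 1 + (2 * l + 1) : ℕ) : ℂ) ≠ 0 := by
      rw [Nat.cast_ne_zero]; omega
    exact_mod_cast this
  · simpa using h0

/-- difference, uniformly -/
lemma rt_eq (k l : ℕ) (h : cls t' k l) :
    rh z t' k - ta z t' l =
    (if k % (2 * t' + 1) < t' then 1 else if t' < k % (2 * t' + 1) then -1 else 1) *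
    ((if k % (2 * t' + 1) = l % (2 * t' + 1) then
      (sg (2 * t' + 1) k - sg (2 * t' + 1) l - z) else 1) *
    (if k % (2 * t' + 1) + l % (2 * t' + 1) + 1 = 2 * t' + 1 then
      (sg (2 * t' + 1) k + sg (2 * t' + 1) l) else 1)) := by
  have hk := Nat.mod_lt k (show 0 < 2 * t' + 1 by omega)
  have hl := Nat.mod_lt l (show 0 < 2 * t' + 1 by omega)
  unfold rh ta
  generalize sg (2 * t' + 1) k = a
  generalize sg (2 * t' + 1) l = b
  unfold cls at h
  generalize k % (2 * t' + 1) = r at *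
  generalize l % (2 * t' + 1) = s at *
  split_ifs <;> first | (exfalso; omega) | ring

lemma rt_ne (hz : ∀ n : ℤ, z ≠ n) (k l : ℕ) (h : cls t' k l) : rh z t' k - ta z t' l ≠ 0 := by
  rw [rt_eq z t' k l h]
  have h1 := sub_ne z hz (2 * t' + 1) (by omega) k l
  have h2 := add_ne (2 * t' + 1) (by omega) k l
  refine mul_ne_zero ?_ (mul_ne_zero ?_ ?_)
  · split_ifs <;> simp
  · split_ifs with h3
    · exact h1 h3
    · exact one_ne_zero
  · split_ifs with h3
    · exact h2
    · exact one_ne_zero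

lemma Kp_cauchy (hz : ∀ n : ℤ, z ≠ n) (k l : ℕ) :
    Kp (sp (2 * t' + 1) (bn (-z))) (sp (2 * t' + 1) (bn z)) k l =
      if cls t' k l then al z t' k * bn (-z - 1) (l / (2 * t' + 1)) / (rh z t' k - ta z t' l)
      else 0 := by
  have ht : 0 < 2 * t' + 1 := by omega
  rw [Kp_closed z hz _ ht]
  split_ifs with h1 h2 h3 h4 h5 h6 h7
  all_goals simp only [dvd_add_iff_mod _ ht] at *
  all_goals first | (exfalso; unfold cls at *; omega) | skip
  · rw [sg_add _ ht _ _ h2, sg_sub _ ht _ _ h1, rt_eq _ _ _ _ h3, if_pos h1, if_pos h2]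
    have h5 := sub_ne z hz (2 * t' + 1) (by omega) k l h1
    have h6 := add_ne (2 * t' + 1) (by omega) k l
    unfold al
    have e1 : ¬ k % (2 * t' + 1) < t' := by omega
    have e2 : ¬ t' < k % (2 * t' + 1)  := by omega
    rw [if_neg e1, if_neg e2, if_neg e1, if_neg e2]
    field_simp
    ring
  · rw [sg_sub _ ht _ _ h1, rt_eq _ _ _ _ (by assumption), if_pos h1, if_neg h2]
    have h5 := sub_ne z hz (2 * t' + 1) (by omega) k l h1
    unfold al
    split_ifs
    · simp
    · field_simp; simp
    · exfalso; omega
  · rw [sg_add _ ht _ _ h5, rt_eq _ _ _ _ h6, if_neg h1, if_pos h5]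
    have h6 := add_ne (2 * t' + 1) (by omega) k l
    unfold al
    split_ifs
    · field_simp; simp
    · field_simp; simp
    · exfalso; omega
  · simp

end weights

section
variable (z : ℂ) (t' : ℕ)

lemma prod_G_aux (t : ℕ) (ht : 0 < t) (a : ℕ) :
    ∏ n ∈ Finset.range a, (if t ∣ n + 1 then Gf z t (n + 1) else 1) =
      bn (z - 1) (a / t) * bn (-z - 1) (a / t) := by
  induction a with
  | zero => simp [bn_zero]
  | succ a ih =>
    rw [Finset.prod_range_succ, ih, Nat.succ_div]
    split_ifs with h
    · rw [bn_succ', bn_succ']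
      have e : a + 1 = t * (a / t + 1) := by
        have := Nat.succ_div (a := a) (b := t)
        rw [if_pos h] at this
        rw [← this, Nat.mul_div_cancel' h]
      unfold Gf
      rw [e]
      have h0 : (t : ℂ) ≠ 0 := by exact_mod_cast ht.ne'
      have h1 : ((a / t : ℕ) : ℂ) + 1 ≠ 0 := by exact_mod_cast Nat.succ_ne_zero (a / t)
      push_cast
      generalize ((a / t : ℕ) : ℂ) = b at *
      field_simp
      ring
    · simp

lemma prod_G (t : ℕ) (ht : 0 < t) (a : ℕ) :
    ∏ l ∈ Finset.range a, (if t ∣ a - l then Gf z t (a - l) else 1) =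
      bn (z - 1) (a / t) * bn (-z - 1) (a / t) := by
  rw [← prod_G_aux z t ht, ← Finset.prod_range_reflect]
  apply Finset.prod_congr rfl
  intro l hl
  have := Finset.mem_range.1 hl
  rw [show a - (a - 1 - l) = l + 1 by omega]

lemma Kp_diag (hz : ∀ n : ℤ, z ≠ n) (a : ℕ) :
    Kp (sp (2 * t' + 1) (bn (-z))) (sp (2 * t' + 1) (bn z)) a a =
      (if (2 * t' + 1) ∣ 2 * a + 1 then 1 - z * (2 * t' + 1 : ℕ) / (2 * a + 1 : ℕ) else 1) *
      ∏ l ∈ Finset.range a, (if (2 * t' + 1) ∣ a - l then Gf z (2 * t' + 1) (a - l) else 1) := by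
  have ht : 0 < 2 * t' + 1 := by omega
  have z0 : z ≠ 0 := by simpa using hz 0
  rw [Kp_closed z hz _ ht, prod_G _ _ ht, if_pos rfl, sub_self, zero_sub,
    show a + a + 1 = 2 * a + 1 by ring]
  split_ifs with h
  · rw [show 2 * a + 1 = a + a + 1 by ring, dvd_add_iff_mod _ ht] at h
    rw [sg_add _ ht _ _ h]
    have h2 := add_ne _ ht a a
    unfold sg at *
    have h0 : ((2 * t' + 1 : ℕ) : ℂ) ≠ 0 := by exact_mod_cast ht.ne'
    have h1 : ((2 * a + 1 : ℕ) : ℂ) ≠ 0 := by exact_mod_cast Nat.succ_ne_zero (2 * a)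
    have e : (2 * (a : ℂ) + 1) = (2 * a + 1 : ℕ) := by push_cast; ring
    rw [e] at *
    generalize ((2 * a + 1 : ℕ) : ℂ) = b at *
    generalize ((2 * t' + 1 : ℕ) : ℂ) = c at *
    field_simp
    ring
  · field_simp
    simp

lemma Gf_ne (hz : ∀ n : ℤ, z ≠ n) (t h : ℕ) (ht : 0 < t) (hh : 0 < h) (hd : t ∣ h) :
    Gf z t h ≠ 0 := by
  obtain ⟨m, rfl⟩ := hd
  have h0 : (t : ℂ) ≠ 0 := by exact_mod_cast ht.ne'
  have h1 : (m : ℂ) ≠ 0 := by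
    rw [Nat.cast_ne_zero]; rintro rfl; simp at hh
  unfold Gf
  intro h
  have e : z * t / (t * m : ℕ) = z / m := by push_cast; field_simp
  rw [e] at h
  field_simp at h
  have : (z - m) * (z + m) = 0 := by linear_combination -h
  rcases mul_eq_zero.1 this with h | h
  · exact hz m (by push_cast; linear_combination h)
  · exact hz (-m) (by push_cast; linear_combination h)

lemma Kp_diag_ne (hz : ∀ n : ℤ, z ≠ n) (a : ℕ) :
    Kp (sp (2 * t' + 1) (bn (-z))) (sp (2 * t' + 1) (bn z)) a a ≠ 0 := by
  rw [Kp_diag z t' hz]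
  have ht : 0 < 2 * t' + 1 := by omega
  apply mul_ne_zero
  · split_ifs with h
    · obtain ⟨m, hm⟩ := h
      have h0 : ((2 * t' + 1 : ℕ) : ℂ) ≠ 0 := by exact_mod_cast ht.ne'
      have h1 : (m : ℂ) ≠ 0 := by
        rw [Nat.cast_ne_zero]; rintro rfl; simp at hm
      rw [hm]
      intro h
      rw [Nat.cast_mul] at h
      generalize ((2 * t' + 1 : ℕ) : ℂ) = c at *
      field_simp at h
      exact hz m (by push_cast; linear_combination -h)
    · exact one_ne_zero
  · rw [Finset.prod_ne_zero_iff]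
    intro l hl
    have := Finset.mem_range.1 hl
    split_ifs with h
    · exact Gf_ne z hz _ _ ht (by omega) h
    · exact one_ne_zero

/-- elimination factors -/
def uu (a k : ℕ) : ℂ := if cls t' k a then (rh z t' k - rh z t' a) / (rh z t' k - ta z t' a) else 1
def vv (a k : ℕ) : ℂ := if cls t' k a then (ta z t' a - ta z t' k) / (rh z t' a - ta z t' k) else 1

lemma cls_symm {k l : ℕ} (h : cls t' k l) : cls t' l k := by unfold cls at *; omega
lemma cls_trans {k l m : ℕ} (h : cls t' k l) (h2 : cls t' l m) : cls t' k m := by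
  unfold cls at *; omega

lemma al_ne (hz : ∀ n : ℤ, z ≠ n) (a : ℕ) :
    al z t' a ≠ 0 ∧ bn (-z - 1) (a / (2 * t' + 1)) ≠ 0 := by
  have h := Kp_diag_ne z t' hz a
  rw [Kp_cauchy z t' hz, if_pos (show cls t' a a from Or.inl rfl)] at h
  constructor
  · rintro h2; rw [h2] at h; simp at h
  · rintro h2; rw [h2] at h; simp at h

lemma Kp_elim (hz : ∀ n : ℤ, z ≠ n) (a k l : ℕ) :
    let K := Kp (sp (2 * t' + 1) (bn (-z))) (sp (2 * t' + 1) (bn z))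
    K k l - K k a * (K a a)⁻¹ * K a l = uu z t' a k * (vv z t' a l * K k l) := by
  intro K
  have haa : cls t' a a := Or.inl rfl
  have hK : K = Kp (sp (2 * t' + 1) (bn (-z))) (sp (2 * t' + 1) (bn z)) := rfl
  obtain ⟨ha1, ha2⟩ := al_ne z t' hz a
  simp only [hK, Kp_cauchy z t' hz]
  rw [if_pos haa]
  by_cases h1 : cls t' k a
  · by_cases h2 : cls t' l a
    · have h3 := cls_trans t' h1 (cls_symm t' h2)
      rw [if_pos h3, if_pos h1, if_pos (cls_symm t' h2)]
      unfold uu vv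
      rw [if_pos h1, if_pos h2]
      have e1 := rt_ne z t' hz k a h1
      have e2 := rt_ne z t' hz a l (cls_symm t' h2)
      have e3 := rt_ne z t' hz k l h3
      have e4 := rt_ne z t' hz a a haa
      generalize rh z t' k = x1 at *
      generalize rh z t' a = x2 at *
      generalize ta z t' l = x3 at *
      generalize ta z t' a = x4 at *
      field_simp
      ring
    · rw [if_neg (fun h => h2 (cls_trans t' (cls_symm t' h) h1)),
        if_neg (fun h => h2 (cls_symm t' h))]
      simp
  · rw [if_neg h1]
    by_cases h3 : cls t' k l
    · have h2 : ¬ cls t' l a := fun h => h1 (cls_trans t' h3 h)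
      unfold uu vv
      rw [if_neg h1, if_neg h2]; simp
    · rw [if_neg h3]; simp

lemma sg_sub_h (t k a : ℕ) (h : k < a) (z : ℂ) (ht : 0 < t) :
    Gf z t (a - k) = 1 - (z / (sg t a - sg t k)) ^ 2 := by
  unfold Gf sg
  have h0 : (t : ℂ) ≠ 0 := by exact_mod_cast ht.ne'
  rw [Nat.cast_sub h.le]
  congr 2
  have : (a : ℂ) - k ≠ 0 := by
    rw [sub_ne_zero]; exact_mod_cast h.ne'
  have e : (2 * (a : ℂ) + 1) / (2 * t) - (2 * k + 1) / (2 * t) = (a - k) / t := by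
    field_simp; ring
  rw [e]
  field_simp

lemma sg_add_h (t k a : ℕ) (z : ℂ) (ht : 0 < t) :
    Gf z t (a + k + 1) = 1 - (z / (sg t a + sg t k)) ^ 2 := by
  unfold Gf sg
  have h0 : (t : ℂ) ≠ 0 := by exact_mod_cast ht.ne'
  congr 2
  have : (a : ℂ) + k + 1 ≠ 0 := by exact_mod_cast Nat.succ_ne_zero (a + k)
  have e : (2 * (a : ℂ) + 1) / (2 * t) + (2 * k + 1) / (2 * t) = (a + k + 1) / t := by
    field_simp; ring
  rw [e]
  push_cast
  field_simp

lemma uv_eq (hz : ∀ n : ℤ, z ≠ n) (a k : ℕ) (h : k < a) :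
    uu z t' a k * vv z t' a k * (if (2 * t' + 1) ∣ a - k then Gf z (2 * t' + 1) (a - k) else 1) =
      if (2 * t' + 1) ∣ a + k + 1 then Gf z (2 * t' + 1) (a + k + 1) else 1 := by
  have ht : 0 < 2 * t' + 1 := by omega
  have hd1 : (2 * t' + 1) ∣ a - k ↔ a % (2 * t' + 1) = k % (2 * t' + 1) := by
    rw [← dvd_sub_iff_mod, ← Int.natCast_dvd_natCast, Nat.cast_sub h.le]
  simp only [hd1, dvd_add_iff_mod _ ht]
  unfold uu vv
  by_cases hc : cls t' k a
  · rw [if_pos hc, if_pos hc, rt_eq z t' k a hc, rt_eq z t' a k (cls_symm t' hc),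
      sg_sub_h _ _ _ h _ ht, sg_add_h _ _ _ _ ht]
    have e1 := fun h => sub_ne z hz (2 * t' + 1) ht k a h
    have e2 := fun h => sub_ne z hz (2 * t' + 1) ht a k h
    have e3 := add_ne (2 * t' + 1) ht a k
    have e4 : sg (2 * t' + 1) a - sg (2 * t' + 1) k ≠ 0 := by
      unfold sg
      have h0 : ((2 * t' + 1 : ℕ) : ℂ) ≠ 0 := by exact_mod_cast ht.ne'
      have e : (2 * (a : ℂ) + 1) / (2 * (2 * t' + 1 : ℕ)) - (2 * k + 1) / (2 * (2 * t' + 1 : ℕ)) =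
          (a - k) / (2 * t' + 1 : ℕ) := by
        field_simp; ring
      rw [e]
      apply div_ne_zero _ h0
      rw [sub_ne_zero]; exact_mod_cast h.ne'
    have hk := Nat.mod_lt k ht
    have hl := Nat.mod_lt a ht
    unfold rh ta
    generalize sg (2 * t' + 1) k = x at *
    generalize sg (2 * t' + 1) a = y at *
    unfold cls at hc
    generalize k % (2 * t' + 1) = r at *
    generalize a % (2 * t' + 1) = s at *
    have e5 : x + y ≠ 0 := by rwa [add_comm]
    split_ifs
    all_goals first | (exfalso; omega) | skip
    all_goals first | have e1 := e1 (by omega) | clear e1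
    all_goals first | have e2 := e2 (by omega) | clear e2
    all_goals try have e6 : (-1 : ℂ) ≠ 0 := by norm_num
    all_goals field_simp
    all_goals ring
  · rw [if_neg hc, if_neg hc]
    unfold cls at hc
    rw [if_neg (by omega), if_neg (by omega)]
    simp

lemma minor_eq_W_generic (hz : ∀ n : ℤ, z ≠ n) (A : Finset ℕ) :
    minor (Kp (sp (2 * t' + 1) (bn (-z))) (sp (2 * t' + 1) (bn z))) A = WA z (2 * t' + 1) A := by
  induction A using Finset.induction_on_max with
  | empty => simp [minor, WA]
  | insert a A h ih =>
    have ha : a ∉ A := fun h' => lt_irrefl _ (h a h')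
    rw [minor_insert _ A a ha (Kp_diag_ne z t' hz a) (uu z t' a) (vv z t' a)
      (fun k _ l _ => Kp_elim z t' hz a k l), ih, WA_insert _ _ _ _ h]
    congr 1
    rw [Kp_diag z t' hz]
    unfold loc
    rw [mul_assoc]
    congr 1
    have hs : A ⊆ Finset.range a := fun x hx => Finset.mem_range.2 (h x hx)
    have : ∏ k ∈ A, uu z t' a k * vv z t' a k =
        ∏ k ∈ Finset.range a, if k ∈ A then uu z t' a k * vv z t' a k else 1 := by
      rw [← Finset.prod_filter, Finset.filter_mem_eq_inter, Finset.inter_eq_right.2 hs]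
    rw [this, ← Finset.prod_mul_distrib]
    apply Finset.prod_congr rfl
    intro l hl
    split_ifs with h1 h2 h3 h4 h5 h6
    all_goals try simp
    all_goals
      have := uv_eq z t' hz a l (Finset.mem_range.1 hl)
      simp_all [mul_comm]

lemma bn_cont (k : ℕ) : Continuous (fun e : ℂ => bn e k) := by
  induction k with
  | zero => exact continuous_const
  | succ k ih => simp only [bn_succ']; fun_prop

lemma sp_cont (t : ℕ) (f : ℂ → ℂ) (hf : Continuous f) (n : ℤ) :
    Continuous (fun e : ℂ => sp t (bn (f e)) n) := by
  unfold sp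
  split_ifs
  · exact (bn_cont _).comp hf
  · exact continuous_const

lemma minor_eq_W (A : Finset ℕ) :
    minor (Kp (sp (2 * t' + 1) (bn (-z))) (sp (2 * t' + 1) (bn z))) A = WA z (2 * t' + 1) A := by
  have hd : Dense (Set.range (fun n : ℤ => (n : ℂ)))ᶜ :=
    (Set.countable_range _).dense_compl ℂ
  have h1 : Continuous (fun z : ℂ =>
      minor (Kp (sp (2 * t' + 1) (bn (-z))) (sp (2 * t' + 1) (bn z))) A) := by
    unfold minor
    apply Continuous.matrix_det
    apply continuous_matrix
    intro i j
    simp only [Matrix.of_apply, Kp]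
    refine continuous_finsetSum _ fun k _ => ?_
    exact (sp_cont _ _ continuous_id _).mul
      ((sp_cont _ _ continuous_neg _).sub (sp_cont _ _ continuous_neg _))
  have h2 : Continuous (fun z : ℂ => WA z (2 * t' + 1) A) := by
    unfold WA loc
    refine continuous_finsetProd _ fun a _ => ?_
    refine Continuous.mul ?_ (continuous_finsetProd _ fun l _ => ?_)
    · split_ifs <;> fun_prop
    · unfold Gf; split_ifs <;> fun_prop
  have := Continuous.ext_on hd h1 h2 (fun w hw => by
    apply minor_eq_W_generic
    intro n hn
    exact hw ⟨n, hn.symm⟩)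
  exact congrFun this z

end

lemma minor_map {S S' : Type*} [CommRing S] [CommRing S'] (φ : S →+* S') (K : ℕ → ℕ → S)
    (A : Finset ℕ) : φ (minor K A) = minor (fun k l => φ (K k l)) A := by
  unfold minor
  rw [RingHom.map_det]
  rfl

lemma Kp_map {S S' : Type*} [CommRing S] [CommRing S'] [Algebra ℚ S] [Algebra ℚ S'] (φ : S →+* S')
    (t : ℕ) (z : S) (k l : ℕ) :
    φ (Kp (sp t (bn (-z))) (sp t (bn z)) k l) =
      Kp (sp t (bn (-(φ z)))) (sp t (bn (φ z))) k l := by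
  unfold Kp
  simp only [map_sum, map_mul, map_sub, sp_map, bn_map, map_neg]

/-- total size of the set `A` -/
def sz (A : Finset ℕ) : ℕ := ∑ a ∈ A, (2 * a + 1)

section
variable (t' : ℕ)

lemma det_B {B : Type*} [CommRing B] [Algebra ℚ B] (φ : ℂ →+* B) (z : ℂ) (x : B) (v : ℕ → B)
    (N : ℕ) :
    (Qm (sp (2 * t' + 1) (bn (-(φ z)))) (fun k => x ^ (2 * k + 1) * v k) N).det =
      ∑ A ∈ (Finset.range N).powerset, x ^ sz A * (∏ k ∈ A, v k) *
        φ ((-1) ^ A.card * WA z (2 * t' + 1) A) := by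
  rw [det_Q_expand _ (sp (2 * t' + 1) (bn (φ z)))]
  · apply Finset.sum_congr rfl
    intro A _
    rw [← minor_eq_W, map_mul, minor_map]
    simp only [Kp_map, map_pow, map_neg, map_one]
    rw [Finset.prod_mul_distrib, Finset.prod_pow_eq_pow_sum]
    unfold sz
    ring
  · apply sp_convInv _ (by omega)
    intro n
    rw [bn_conv_neg]
  · have := sp_nat (2 * t' + 1) (bn (φ z)) 0
    simpa [bn_zero] using this

/-- weights -/
def nu (k : ℕ) : Fin t' → ℤ := fun r =>
  (if k % (2 * t' + 1) = r then 1 else 0) - (if k % (2 * t' + 1) + r + 1 = 2 * t' + 1 then 1 else 0)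

def nuA (A : Finset ℕ) : Fin t' → ℤ := ∑ a ∈ A, nu t' a

abbrev VV := AddMonoidAlgebra ℂ (Fin t' → ℤ)

def LV (N : ℕ) (z : ℂ) : PowerSeries (VV t') :=
  ∑ A ∈ (Finset.range N).powerset,
    PowerSeries.C (AddMonoidAlgebra.single (nuA t' A) ((-1) ^ A.card * WA z (2 * t' + 1) A)) *
      X ^ sz A

/-- product in complex power series -/
def RC (K : ℕ) (z : ℂ) (q : PowerSeries ℂ) : PowerSeries ℂ :=
  RR K (PowerSeries.C (Ez (2 * t' + 1) z)) (PowerSeries.C (1 - z)) q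

lemma nu_prod (A : Finset ℕ) (f : VV t' →+* PowerSeries (VV t')) :
    ∏ a ∈ A, f (AddMonoidAlgebra.single (nu t' a) (1 : ℂ)) =
      f (AddMonoidAlgebra.single (nuA t' A) 1) := by
  rw [← map_prod]
  congr 1
  unfold nuA
  induction A using Finset.induction_on with
  | empty => simp; rfl
  | insert a A h ih =>
    rw [Finset.prod_insert h, Finset.sum_insert h, ih, AddMonoidAlgebra.single_mul_single, one_mul]

theorem LV_formula (K N : ℕ) (hK : 1 ≤ K) (hN : 2 * K ≤ N) (z : ℂ) :
    (X : PowerSeries (VV t')) ^ K ∣ LV t' N z -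
      LV t' N 1 * PowerSeries.map (algebraMap ℂ (VV t')) (RC t' K z (X ^ (2 * t' + 1))) := by
  set I : Ideal (PowerSeries (VV t')) := Ideal.span {(X : PowerSeries (VV t')) ^ K} with hI
  rw [← Ideal.mem_span_singleton, ← hI, ← Ideal.Quotient.mk_eq_mk_iff_sub_mem]
  set mk := Ideal.Quotient.mk I with hmk
  set ψ : PowerSeries ℂ →+* (PowerSeries (VV t') ⧸ I) :=
    mk.comp (PowerSeries.map (algebraMap ℂ (VV t'))) with hψ
  set φ : ℂ →+* (PowerSeries (VV t') ⧸ I) := ψ.comp (PowerSeries.C) with hφ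
  have hx : (mk X) ^ K = 0 := by
    rw [← map_pow]
    exact Ideal.Quotient.eq_zero_iff_mem.2 (Ideal.mem_span_singleton_self _)
  set v : ℕ → (PowerSeries (VV t') ⧸ I) := fun k =>
    mk (PowerSeries.C (AddMonoidAlgebra.single (nu t' k) (1 : ℂ))) with hv
  have ht : 0 < 2 * t' + 1 := by omega
  have main := det_formula t' K N hK hN (mk X) (φ z) hx v ?_ ?_ ?_
  · have hLV : ∀ w : ℂ, mk (LV t' N w) =
        (Qm (sp (2 * t' + 1) (bn (-(φ w)))) (fun k => (mk X) ^ (2 * k + 1) * v k) N).det := by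
      intro w
      rw [det_B, LV, map_sum]
      apply Finset.sum_congr rfl
      intro A _
      have h1 : ∏ k ∈ A, v k = mk (PowerSeries.C (AddMonoidAlgebra.single (nuA t' A) (1 : ℂ))) := by
        rw [← nu_prod t' A (PowerSeries.C), map_prod]
      have h2 : φ ((-1) ^ A.card * WA w (2 * t' + 1) A) = mk (PowerSeries.C
          (AddMonoidAlgebra.single 0 ((-1) ^ A.card * WA w (2 * t' + 1) A))) := by
        simp only [hφ, hψ, RingHom.comp_apply, PowerSeries.map_C]
        rfl
      rw [h1, h2, ← map_pow, ← map_mul, ← map_mul, mul_assoc, ← map_mul,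
        AddMonoidAlgebra.single_mul_single, add_zero, one_mul, mul_comm]
    rw [map_mul, hLV, hLV]
    have e1 : -(φ 1) = -1 := by simp
    rw [e1, main]
    congr 1
    have : mk (PowerSeries.map (algebraMap ℂ (VV t')) (RC t' K z (X ^ (2 * t' + 1)))) =
      ψ (RC t' K z (X ^ (2 * t' + 1))) := rfl
    rw [this, RC, RR_map]
    congr 1
    · exact (Ez_map φ _ z).symm
    · simp [hφ]
    · simp [hψ]
  · intro l i
    simp only [hv]
    congr 3
    unfold nu
    simp
  · intro l l' h
    rw [dvd_add_iff_mod _ ht] at h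
    simp only [hv]
    rw [← map_mul, ← map_mul, AddMonoidAlgebra.single_mul_single]
    have : nu t' l + nu t' l' = 0 := by
      ext r
      have := r.2
      simp only [nu, Pi.add_apply, Pi.zero_apply]
      split_ifs <;> omega
    rw [this, one_mul]
    exact (map_one (mk.comp PowerSeries.C))
  · intro l h
    rw [show 2 * l + 1 = l + l + 1 by ring, dvd_add_iff_mod _ ht] at h
    simp only [hv]
    have : nu t' l = 0 := by
      ext r
      have := r.2
      simp only [nu, Pi.zero_apply]
      split_ifs <;> omega
    rw [this]
    exact (map_one (mk.comp PowerSeries.C))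

end

/-- number of factors attached to `a` -/
def wloc (t : ℕ) (A : Finset ℕ) (a : ℕ) : ℕ :=
  (if t ∣ 2 * a + 1 then 1 else 0) +
  ∑ l ∈ Finset.range a, if l ∈ A then (if t ∣ a + l + 1 then 2 else 0)
    else (if t ∣ a - l then 2 else 0)

/-- number of factors -/
def wA (t : ℕ) (A : Finset ℕ) : ℕ := ∑ a ∈ A, wloc t A a

lemma wloc_congr (t : ℕ) (A B : Finset ℕ) (a : ℕ) (h : ∀ l < a, (l ∈ A ↔ l ∈ B)) :
    wloc t A a = wloc t B a := by
  unfold wloc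
  congr 1
  apply Finset.sum_congr rfl
  intro l hl
  simp only [h l (Finset.mem_range.1 hl)]

lemma wA_insert (t : ℕ) (A : Finset ℕ) (a : ℕ) (h : ∀ x ∈ A, x < a) :
    wA t (insert a A) = wloc t A a + wA t A := by
  unfold wA
  have ha : a ∉ A := fun h' => lt_irrefl _ (h a h')
  rw [Finset.sum_insert ha]
  congr 1
  · apply wloc_congr
    intro l hl
    simp [hl.ne]
  · apply Finset.sum_congr rfl
    intro b hb
    apply wloc_congr
    intro l hl
    have := h b hb
    simp [show l ≠ a by omega]

section
variable (t' : ℕ)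

def ee (n : Fin t' → ℤ) : ℤ :=
  ∑ r : Fin t', ((2 * t' + 1) * n r ^ 2 + 2 * ((r : ℤ) - t') * n r)

lemma ee_single (n : Fin t' → ℤ) (r : Fin t') (c : ℤ) :
    ee t' (n + Pi.single r c) = ee t' n + (2 * t' + 1) * (2 * n r * c + c ^ 2) +
      2 * ((r : ℤ) - t') * c := by
  rw [add_assoc, ← sub_eq_iff_eq_add']
  unfold ee
  rw [← Finset.sum_sub_distrib, Finset.sum_eq_single r]
  · simp; ring
  · intro b _ hb
    simp [Pi.single_eq_of_ne hb]
  · simp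

def cZ (A : Finset ℕ) (s : ℕ) : ℤ := ∑ b ∈ A, if b % (2 * t' + 1) = s then 1 else 0

lemma nuA_eq (A : Finset ℕ) (r : Fin t') : nuA t' A r = cZ t' A r - cZ t' A (2 * t' - r) := by
  unfold nuA cZ
  rw [Finset.sum_apply, ← Finset.sum_sub_distrib]
  apply Finset.sum_congr rfl
  intro b _
  have := r.2
  unfold nu
  congr 2
  simp only [eq_iff_iff]
  omega

lemma sum_G_aux (t : ℕ) (ht : 0 < t) (a : ℕ) :
    ∑ n ∈ Finset.range a, (if t ∣ n + 1 then (2 : ℤ) else 0) = 2 * (a / t : ℕ) := by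
  induction a with
  | zero => simp
  | succ a ih =>
    rw [Finset.sum_range_succ, ih, Nat.succ_div]
    split_ifs <;> push_cast <;> ring

lemma sum_G (t : ℕ) (ht : 0 < t) (a : ℕ) :
    ∑ l ∈ Finset.range a, (if t ∣ a - l then (2 : ℤ) else 0) = 2 * (a / t : ℕ) := by
  rw [← sum_G_aux t ht, ← Finset.sum_range_reflect]
  apply Finset.sum_congr rfl
  intro l hl
  have := Finset.mem_range.1 hl
  rw [show a - (a - 1 - l) = l + 1 by omega]

lemma wloc_eq (A : Finset ℕ) (a : ℕ) (h : ∀ x ∈ A, x < a) :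
    (wloc (2 * t' + 1) A a : ℤ) = (if a % (2 * t' + 1) = t' then 1 else 0) +
      2 * (a / (2 * t' + 1) : ℕ) + 2 * cZ t' A (2 * t' - a % (2 * t' + 1)) -
        2 * cZ t' A (a % (2 * t' + 1)) := by
  have ht : 0 < 2 * t' + 1 := by omega
  have hs : A ⊆ Finset.range a := fun x hx => Finset.mem_range.2 (h x hx)
  have e : ∀ f : ℕ → ℤ, ∑ k ∈ A, f k = ∑ k ∈ Finset.range a, if k ∈ A then f k else 0 := by
    intro f
    rw [← Finset.sum_filter, Finset.filter_mem_eq_inter, Finset.inter_eq_right.2 hs]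
  have hm := Nat.mod_lt a ht
  unfold wloc cZ
  rw [← sum_G _ ht, e, e, Finset.mul_sum, Finset.mul_sum, show 2 * a + 1 = a + a + 1 by ring]
  simp only [dvd_add_iff_mod _ ht]
  have hg : ∀ p q r s : ℤ, p + q + r - s = p + (q + r - s) := by intros; ring
  rw [Nat.cast_add, hg]
  congr 1
  · have : (a % (2 * t' + 1) + a % (2 * t' + 1) + 1 = 2 * t' + 1) ↔ a % (2 * t' + 1) = t' := by omega
    simp only [this]
    split_ifs <;> simp
  · rw [← Finset.sum_add_distrib, ← Finset.sum_sub_distrib, Nat.cast_sum]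
    apply Finset.sum_congr rfl
    intro l hl
    have hla := Finset.mem_range.1 hl
    have hd1 : (2 * t' + 1) ∣ a - l ↔ a % (2 * t' + 1) = l % (2 * t' + 1) := by
      rw [← dvd_sub_iff_mod, ← Int.natCast_dvd_natCast, Nat.cast_sub hla.le]
    have hml := Nat.mod_lt l ht
    simp only [hd1]
    split_ifs <;> first | (exfalso; omega) | simp

lemma nu_lt (a : ℕ) (h : a % (2 * t' + 1) < t') : nu t' a = Pi.single ⟨a % (2 * t' + 1), h⟩ 1 := by
  ext r
  unfold nu
  by_cases hr : r = ⟨a % (2 * t' + 1), h⟩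
  · subst hr
    simp only [Pi.single_eq_same]
    split_ifs <;> first | (exfalso; omega) | simp
  · rw [Pi.single_eq_of_ne hr]
    have h1 : (r : ℕ) ≠ a % (2 * t' + 1) := fun h' => hr (Fin.ext h')
    have := r.2
    split_ifs <;> first | (exfalso; omega) | simp

lemma nu_gt (a : ℕ) (h : t' < a % (2 * t' + 1)) :
    nu t' a = Pi.single ⟨2 * t' - a % (2 * t' + 1), by
      have := Nat.mod_lt a (show 0 < 2 * t' + 1 by omega); omega⟩ (-1) := by
  have hm := Nat.mod_lt a (show 0 < 2 * t' + 1 by omega)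
  ext r
  unfold nu
  by_cases hr : r = ⟨2 * t' - a % (2 * t' + 1), by omega⟩
  · subst hr
    simp only [Pi.single_eq_same]
    split_ifs <;> first | (exfalso; omega) | simp
  · rw [Pi.single_eq_of_ne hr]
    have h1 : (r : ℕ) ≠ 2 * t' - a % (2 * t' + 1) := fun h' => hr (Fin.ext h')
    have := r.2
    split_ifs <;> first | (exfalso; omega) | simp

lemma nu_mid (a : ℕ) (h : t' = a % (2 * t' + 1)) : nu t' a = 0 := by
  ext r
  have := r.2
  unfold nu
  simp only [Pi.zero_apply]
  split_ifs <;> omega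

lemma sz_eq (A : Finset ℕ) : (sz A : ℤ) = ee t' (nuA t' A) + (2 * t' + 1) * wA (2 * t' + 1) A := by
  induction A using Finset.induction_on_max with
  | empty => simp [sz, nuA, ee, wA]
  | insert a A h ih =>
    have ha : a ∉ A := fun h' => lt_irrefl _ (h a h')
    have e1 : sz (insert a A) = 2 * a + 1 + sz A := by unfold sz; rw [Finset.sum_insert ha]
    have e2 : nuA t' (insert a A) = nuA t' A + nu t' a := by
      unfold nuA; rw [Finset.sum_insert ha, add_comm]
    rw [wA_insert _ _ _ h, e1, e2, Nat.cast_add, Nat.cast_add, ih, Nat.cast_add (wloc _ _ _), wloc_eq t' A a h]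
    have hm := Nat.mod_lt a (show 0 < 2 * t' + 1 by omega)
    have hdm : (a : ℤ) = (2 * t' + 1) * (a / (2 * t' + 1) : ℕ) + (a % (2 * t' + 1) : ℕ) := by
      exact_mod_cast (Nat.div_add_mod a (2 * t' + 1)).symm
    rw [Nat.cast_mul, Nat.cast_one, Nat.cast_two, hdm]
    rcases lt_trichotomy (a % (2 * t' + 1)) t' with h1 | h1 | h1
    · rw [nu_lt t' a h1, ee_single, nuA_eq, if_neg (by omega)]
      simp only
      ring
    · rw [nu_mid t' a h1.symm, add_zero, if_pos h1, h1, show 2 * t' - t' = t' by omega]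
      ring
    · rw [nu_gt t' a h1, ee_single, nuA_eq, if_neg (by omega)]
      simp only
      rw [show 2 * t' - (2 * t' - a % (2 * t' + 1)) = a % (2 * t' + 1) by omega,
        Nat.cast_sub (by omega)]
      push_cast
      ring

lemma Gf_one (t : ℕ) (ht : 0 < t) : Gf 1 t t = 0 := by
  unfold Gf
  have : (t : ℂ) ≠ 0 := by exact_mod_cast ht.ne'
  field_simp
  simp

lemma W_one (A : Finset ℕ) (hW : WA 1 (2 * t' + 1) A ≠ 0) : wA (2 * t' + 1) A = 0 := by
  have ht : 0 < 2 * t' + 1 := by omega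
  unfold WA at hW
  rw [Finset.prod_ne_zero_iff] at hW
  have c1 : ∀ a ∈ A, a ≠ t' := by
    rintro a ha rfl
    apply hW a ha
    unfold loc
    rw [if_pos (dvd_refl _), one_mul, div_self, sub_self, zero_mul]
    exact_mod_cast ht.ne'
  have c2 : ∀ a ∈ A, ∀ l ∈ A, l < a → a + l + 1 ≠ 2 * t' + 1 := by
    intro a ha l hl hla h
    apply hW a ha
    unfold loc
    apply mul_eq_zero_of_right
    apply Finset.prod_eq_zero (Finset.mem_range.2 hla)
    rw [if_pos hl, if_pos (by rw [h]), h, Gf_one _ ht]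
  have c3 : ∀ a ∈ A, 2 * t' + 1 ≤ a → a - (2 * t' + 1) ∈ A := by
    intro a ha h
    by_contra hl
    apply hW a ha
    unfold loc
    apply mul_eq_zero_of_right
    apply Finset.prod_eq_zero (Finset.mem_range.2 (show a - (2 * t' + 1) < a by omega))
    rw [if_neg hl, show a - (a - (2 * t' + 1)) = 2 * t' + 1 by omega, if_pos (dvd_refl _),
      Gf_one _ ht]
  have c4 : ∀ m b : ℕ, b + (2 * t' + 1) * m ∈ A → b ∈ A := by
    intro m
    induction m with
    | zero => intro b hb; simpa using hb
    | succ m ih =>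
      intro b hb
      apply ih
      have := c3 _ hb (by rw [mul_add]; omega)
      convert this using 1
      rw [mul_add]; omega
  have c5 : ∀ a ∈ A, a % (2 * t' + 1) ∈ A := by
    intro a ha
    apply c4 (a / (2 * t' + 1))
    rwa [Nat.mod_add_div]
  have c6 : ∀ a ∈ A, ∀ l ∈ A, a + l + 1 ≠ 2 * t' + 1 := by
    intro a ha l hl h
    rcases lt_trichotomy l a with h1 | h1 | h1
    · exact c2 a ha l hl h1 h
    · exact c1 a ha (by omega)
    · exact c2 l hl a ha h1 (by omega)
  have c7 : ∀ a ∈ A, ∀ l ∈ A, ¬ (2 * t' + 1) ∣ a + l + 1 := by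
    intro a ha l hl h
    rw [dvd_add_iff_mod _ ht] at h
    exact c6 _ (c5 a ha) _ (c5 l hl) h
  unfold wA
  apply Finset.sum_eq_zero
  intro a ha
  unfold wloc
  rw [show 2 * a + 1 = a + a + 1 by ring, if_neg (c7 a ha a ha), zero_add]
  apply Finset.sum_eq_zero
  intro l hl
  have hla := Finset.mem_range.1 hl
  split_ifs with h1 h2 h3
  · exact absurd h2 (c7 a ha l h1)
  · rfl
  · exfalso
    apply h1
    obtain ⟨m, hm⟩ := h3
    apply c4 m
    rwa [← hm, show l + (a - l) = a by omega]
  · rfl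

/-- the finite sum -/
def LC (N : ℕ) (y z : ℂ) : PowerSeries ℂ :=
  ∑ A ∈ (Finset.range N).powerset,
    PowerSeries.C ((-1) ^ A.card * (y ^ wA (2 * t' + 1) A * WA z (2 * t' + 1) A)) * X ^ sz A

/-- the functional -/
def Ph (n : ℕ) (u : ℂ) : VV t' →ₗ[ℂ] ℂ :=
  (Finsupp.lsum ℂ (fun g => (u ^ ((n : ℤ) - ee t' g).toNat) • LinearMap.id)) ∘ₗ
    (AddMonoidAlgebra.coeffLinearEquiv ℂ).toLinearMap

lemma Ph_single (n : ℕ) (u : ℂ) (g : Fin t' → ℤ) (c : ℂ) :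
    Ph t' n u (AddMonoidAlgebra.single g c) = u ^ ((n : ℤ) - ee t' g).toNat * c := by
  unfold Ph
  simp [AddMonoidAlgebra.coeffLinearEquiv]

end

lemma LC_formula (t' : ℕ) (K N : ℕ) (hK : 1 ≤ K) (hN : 2 * K ≤ N) (y z : ℂ) :
    (X : PowerSeries ℂ) ^ K ∣ LC t' N y z -
      LC t' N 1 1 * RC t' K z (PowerSeries.C y * X ^ (2 * t' + 1)) := by
  obtain ⟨u, hu⟩ := IsAlgClosed.exists_pow_nat_eq y (show 0 < 2 * t' + 1 by omega)
  have hF := LV_formula t' K N hK hN z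
  rw [PowerSeries.X_pow_dvd_iff] at hF ⊢
  intro n hn
  have h := hF n hn
  rw [map_sub, sub_eq_zero] at h ⊢
  have h2 := congrArg (Ph t' n u) h
  have hR : RC t' K z (PowerSeries.C y * X ^ (2 * t' + 1)) =
      rescale u (RC t' K z (X ^ (2 * t' + 1))) := by
    unfold RC
    rw [RR_map]
    congr 1
    · ext m
      rw [coeff_rescale, coeff_C]
      split_ifs with hm <;> simp [hm]
    · ext m
      rw [coeff_rescale, coeff_C]
      split_ifs with hm <;> simp [hm]
    · rw [map_pow, rescale_X, mul_pow, ← map_pow, hu]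
  rw [hR]
  set R := RC t' K z (X ^ (2 * t' + 1)) with hRdef
  convert h2 using 1
  · unfold LC LV
    rw [map_sum, map_sum, map_sum]
    apply Finset.sum_congr rfl
    intro A _
    rw [coeff_C_mul_X_pow, coeff_C_mul_X_pow]
    split_ifs with hA
    · rw [Ph_single]
      have e : ((n : ℤ) - ee t' (nuA t' A)).toNat = (2 * t' + 1) * wA (2 * t' + 1) A := by
        rw [hA, sz_eq t' A, add_sub_cancel_left]
        exact_mod_cast Int.toNat_natCast _
      rw [e, pow_mul, hu]
      ring
    · rw [map_zero]
  · unfold LC LV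
    rw [Finset.sum_mul, Finset.sum_mul, map_sum, map_sum, map_sum]
    apply Finset.sum_congr rfl
    intro A _
    rw [mul_assoc, mul_assoc, coeff_C_mul, coeff_C_mul, coeff_X_pow_mul', coeff_X_pow_mul']
    split_ifs with hA
    · rw [coeff_map, mul_comm (AddMonoidAlgebra.single _ _), ← Algebra.smul_def, LinearMap.map_smul, smul_eq_mul, Ph_single, coeff_rescale]
      by_cases hW : WA 1 (2 * t' + 1) A = 0
      · rw [hW]; simp
      · have e : ((n : ℤ) - ee t' (nuA t' A)).toNat = n - sz A := by
          have := sz_eq t' A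
          rw [W_one t' A hW] at this
          omega
        rw [e, one_pow]
        ring
    · simp

section young
variable (μ : YoungDiagram)

def DD : Finset ℕ := (μ.cells.filter fun c => c.1 = c.2).image Prod.fst

lemma mem_DD (i : ℕ) : i ∈ DD μ ↔ i < μ.rowLen i := by
  rw [← YoungDiagram.mem_iff_lt_rowLen]
  unfold DD
  simp only [Finset.mem_image, Finset.mem_filter, YoungDiagram.mem_cells, Prod.exists,
    exists_and_right, exists_eq_right]
  constructor
  · rintro ⟨x, h, rfl⟩; exact h
  · intro h; exact ⟨i, h, rfl⟩

lemma card_DD : (DD μ).card = durfee μ := by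
  unfold DD durfee
  apply Finset.card_image_of_injOn
  rintro ⟨a, b⟩ h ⟨c, d⟩ h' e
  simp at h h' e
  ext <;> simp <;> omega

def bb (i : ℕ) : ℕ := μ.rowLen i - i - 1

def toA : Finset ℕ := (DD μ).image (bb μ)

lemma bb_lt {i j : ℕ} (hij : i < j) (hj : j ∈ DD μ) : bb μ j < bb μ i := by
  rw [mem_DD] at hj
  have := μ.rowLen_anti i j hij.le
  unfold bb
  omega

lemma bb_inj : Set.InjOn (bb μ) (DD μ) := by
  intro i hi j hj h
  rcases lt_trichotomy i j with h1 | h1 | h1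
  · have := bb_lt μ h1 hj; omega
  · exact h1
  · have := bb_lt μ h1 hi; omega

lemma card_toA : (toA μ).card = durfee μ := by
  rw [← card_DD]
  exact Finset.card_image_of_injOn (bb_inj μ)

variable {μ}

lemma colLen_sc (hμ : μ.transpose = μ) (j : ℕ) : μ.colLen j = μ.rowLen j := by
  rw [← YoungDiagram.rowLen_transpose, hμ]

lemma mem_symm (hμ : μ.transpose = μ) (i j : ℕ) : (i, j) ∈ μ ↔ (j, i) ∈ μ := by
  conv_lhs => rw [← hμ, YoungDiagram.mem_transpose]
  rfl

lemma mem_alt (hμ : μ.transpose = μ) (i j : ℕ) : (i, j) ∈ μ ↔ i < μ.rowLen j := by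
  rw [mem_symm hμ, YoungDiagram.mem_iff_lt_rowLen]

lemma hook_ne (hμ : μ.transpose = μ) (i j : ℕ) : (j < μ.rowLen i ∧ i < μ.rowLen j) ∨ (μ.rowLen i ≤ j ∧ μ.rowLen j ≤ i) := by
  have h1 := mem_alt hμ i j
  rw [YoungDiagram.mem_iff_lt_rowLen] at h1
  omega

lemma prod_row {M : Type*} [CommMonoid M] (hμ : μ.transpose = μ) (g : ℕ → M) (i : ℕ) (hi : i ∈ DD μ) :
    ∏ j ∈ Finset.Ioo i (μ.rowLen i), g (μ.rowLen i + μ.rowLen j - i - j - 1) =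
    ∏ l ∈ Finset.range (bb μ i),
      if l ∈ toA μ then g (bb μ i + l + 1) else g (bb μ i - l) := by
  classical
  have hi' := (mem_DD μ i).1 hi
  set φ : ℕ → ℕ := fun j => if j ∈ DD μ then bb μ j else j - μ.rowLen j with hφ
  have key1 : ∀ j, φ j ∈ toA μ ↔ j ∈ DD μ := by
    intro j
    constructor
    · intro h
      by_contra hj
      simp only [hφ, if_neg hj] at h
      unfold toA at h
      rw [Finset.mem_image] at h
      obtain ⟨k, hk, e⟩ := h
      rw [mem_DD] at hj hk
      unfold bb at e
      have := hook_ne hμ j k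
      omega
    · intro h
      simp only [hφ, if_pos h]
      exact Finset.mem_image_of_mem _ h
  have hmap : ∀ j ∈ Finset.Ioo i (μ.rowLen i), φ j ∈ Finset.range (bb μ i) := by
    intro j hj
    rw [Finset.mem_Ioo] at hj
    rw [Finset.mem_range]
    simp only [hφ]
    split_ifs with h
    · exact bb_lt μ hj.1 h
    · have := hook_ne hμ i j
      unfold bb
      omega
  have hinj : Set.InjOn φ (Finset.Ioo i (μ.rowLen i)) := by
    intro j hj k hk h
    by_cases h1 : j ∈ DD μ
    · have h2 : k ∈ DD μ := by rwa [← key1, ← h, key1]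
      simp only [hφ, if_pos h1, if_pos h2] at h
      exact bb_inj μ h1 h2 h
    · have h2 : k ∉ DD μ := by rwa [← key1, ← h, key1]
      simp only [hφ, if_neg h1, if_neg h2] at h
      rw [mem_DD] at h1 h2
      have := μ.rowLen_anti j k
      have := μ.rowLen_anti k j
      omega
  apply Finset.prod_nbij φ hmap hinj
  · apply Finset.surjOn_of_injOn_of_card_le φ hmap hinj
    simp [bb]
  · intro j hj
    rw [Finset.mem_Ioo] at hj
    have h3 := hook_ne hμ i j
    by_cases h : j ∈ DD μ
    · rw [if_pos ((key1 j).2 h)]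
      simp only [hφ, if_pos h]
      rw [mem_DD] at h
      congr 1
      unfold bb
      omega
    · rw [if_neg (fun h' => h ((key1 j).1 h'))]
      simp only [hφ, if_neg h]
      rw [mem_DD] at h
      congr 1
      unfold bb
      omega

lemma prod_cells {M : Type*} [CommMonoid M] (hμ : μ.transpose = μ) (f : ℕ × ℕ → M) :
    ∏ c ∈ μ.cells, f c = ∏ i ∈ DD μ, (f (i, i) *
      ∏ j ∈ Finset.Ioo i (μ.rowLen i), f (i, j) * f (j, i)) := by
  classical
  rw [Finset.prod_mul_distrib]
  simp only [Finset.prod_mul_distrib]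
  rw [← Finset.prod_filter_mul_prod_filter_not μ.cells (fun c => c.1 = c.2)]
  rw [← Finset.prod_filter_mul_prod_filter_not (μ.cells.filter (fun c => ¬ c.1 = c.2))
    (fun c => c.1 < c.2)]
  rw [Finset.filter_filter, Finset.filter_filter]
  congr 1
  · unfold DD
    rw [Finset.prod_image]
    · apply Finset.prod_congr rfl
      rintro ⟨i, j⟩ h
      simp at h
      simp [h.2]
    · rintro ⟨a, b⟩ h ⟨c, d⟩ h' e
      simp at h h' e
      ext <;> simp <;> omega
  have key : ∀ F : ℕ → ℕ → M, ∏ i ∈ DD μ, ∏ j ∈ Finset.Ioo i (μ.rowLen i), F i j =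
      ∏ c ∈ (μ.cells.filter fun c => c.1 < c.2), F c.1 c.2 := by
    intro F
    rw [Finset.prod_sigma']
    refine Finset.prod_bij' (fun x _ => (x.1, x.2)) (fun c _ => ⟨c.1, c.2⟩) ?_ ?_ ?_ ?_ ?_
    · rintro ⟨i, j⟩ h
      simp [mem_DD] at h ⊢
      rw [YoungDiagram.mem_iff_lt_rowLen]
      omega
    · rintro ⟨i, j⟩ h
      simp [mem_DD] at h ⊢
      rw [YoungDiagram.mem_iff_lt_rowLen] at h
      omega
    · rintro ⟨i, j⟩ h; rfl
    · rintro ⟨i, j⟩ h; rfl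
    · rintro ⟨i, j⟩ h; rfl
  rw [key (fun i j => f (i, j)), key (fun i j => f (j, i))]
  congr 1
  · apply Finset.prod_congr
    · ext ⟨i, j⟩
      simp
      omega
    · intros; rfl
  · refine Finset.prod_bij' (fun c _ => (c.2, c.1)) (fun c _ => (c.2, c.1)) ?_ ?_ ?_ ?_ ?_
    · rintro ⟨i, j⟩ h
      simp at h ⊢
      rw [mem_symm hμ]
      exact ⟨h.1, by omega⟩
    · rintro ⟨i, j⟩ h
      simp at h ⊢
      rw [mem_symm hμ]
      exact ⟨h.1, by omega, by omega⟩
    · rintro ⟨i, j⟩ h; rfl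
    · rintro ⟨i, j⟩ h; rfl
    · rintro ⟨i, j⟩ h; rfl

lemma card_sc (hμ : μ.transpose = μ) : μ.card = sz (toA μ) := by
  have h := prod_cells hμ (M := Multiplicative ℕ) (fun _ => Multiplicative.ofAdd 1)
  have h2 : ∑ c ∈ μ.cells, 1 = ∑ i ∈ DD μ, (1 + ∑ j ∈ Finset.Ioo i (μ.rowLen i), (1 + 1)) := h
  unfold sz toA
  rw [Finset.sum_image (bb_inj μ), YoungDiagram.card, Finset.card_eq_sum_ones, h2]
  apply Finset.sum_congr rfl
  intro i hi
  rw [mem_DD] at hi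
  simp [bb]
  omega

lemma hook_prod (hμ : μ.transpose = μ) (t : ℕ) (y z : ℂ) :
    ∏ c ∈ μ.cells.filter (fun c => t ∣ hookLen μ c),
      (y - y * z * (t : ℕ) / ((hookLen μ c : ℂ) * eps c)) =
    y ^ wA t (toA μ) * WA z t (toA μ) := by
  rw [Finset.prod_filter, prod_cells hμ]
  have h1 : ∀ A : Finset ℕ, y ^ wA t A * WA z t A = ∏ a ∈ A, (y ^ wloc t A a * loc z t A a) := by
    intro A
    rw [Finset.prod_mul_distrib, Finset.prod_pow_eq_pow_sum]
    rfl
  rw [h1]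
  conv_rhs => unfold toA
  rw [Finset.prod_image (bb_inj μ)]
  apply Finset.prod_congr rfl
  intro i hi
  have hi' := (mem_DD μ i).1 hi
  have hk : ∀ i j, hookLen μ (i, j) = μ.rowLen i + μ.rowLen j - i - j - 1 := by
    intro i j
    unfold hookLen
    simp only [colLen_sc hμ]
  have h2 : ∀ j ∈ Finset.Ioo i (μ.rowLen i),
      ((if t ∣ hookLen μ (i, j) then y - y * z * (t : ℕ) / ((hookLen μ (i, j) : ℂ) * eps (i, j)) else 1) *
      (if t ∣ hookLen μ (j, i) then y - y * z * (t : ℕ) / ((hookLen μ (j, i) : ℂ) * eps (j, i)) else 1)) =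
      (fun h => if t ∣ h then y ^ 2 * Gf z t h else 1) (μ.rowLen i + μ.rowLen j - i - j - 1) := by
    intro j hj
    rw [Finset.mem_Ioo] at hj
    have e : hookLen μ (j, i) = hookLen μ (i, j) := by rw [hk, hk]; omega
    rw [e, hk]
    simp only
    split_ifs with h
    · rw [eps, eps, if_pos hj.1, if_neg (by simp; omega)]
      unfold Gf
      simp only [mul_one, mul_neg, div_neg]
      ring
    · simp
  rw [Finset.prod_congr rfl h2, prod_row hμ (fun h => if t ∣ h then y ^ 2 * Gf z t h else 1) i hi]
  change _ = y ^ wloc t (toA μ) (bb μ i) * loc z t (toA μ) (bb μ i)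
  unfold wloc loc
  rw [pow_add, ← Finset.prod_pow_eq_pow_sum]
  have h3 : ∀ p q r s : ℂ, p * q * (r * s) = (p * r) * (q * s) := by intros; ring
  rw [h3, ← Finset.prod_mul_distrib]
  congr 1
  · have : hookLen μ (i, i) = 2 * bb μ i + 1 := by rw [hk]; unfold bb; omega
    rw [this]
    simp only [eps, lt_irrefl, if_false, mul_one]
    split_ifs
    · rw [pow_one]; ring
    · simp
  · apply Finset.prod_congr rfl
    intro l _
    split_ifs <;> simp

end young

/-- number of elements at least `k` -/
def cA (A : Finset ℕ) (k : ℕ) : ℕ := (A.filter fun l => k ≤ l).card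

lemma cA_succ (A : Finset ℕ) (k : ℕ) : cA A k = cA A (k + 1) + if k ∈ A then 1 else 0 := by
  unfold cA
  have : (A.filter fun l => k ≤ l) = (A.filter fun l => k + 1 ≤ l) ∪ (A.filter fun l => l = k) := by
    ext l
    simp
    constructor
    · rintro ⟨h1, h2⟩
      by_cases h : l = k
      · exact Or.inr ⟨h1, h⟩
      · exact Or.inl ⟨h1, by omega⟩
    · rintro (⟨h1, h2⟩ | ⟨h1, h2⟩)
      · exact ⟨h1, by omega⟩
      · exact ⟨h1, by omega⟩
  rw [this, Finset.card_union_of_disjoint]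
  · congr 1
    rw [Finset.filter_eq']
    split_ifs <;> simp
  · rw [Finset.disjoint_left]
    intro l h1 h2
    simp at h1 h2
    omega

lemma cA_anti (A : Finset ℕ) : Antitone (cA A) := by
  apply antitone_nat_of_succ_le
  intro k
  rw [cA_succ A k]
  omega

lemma cA_lip (A : Finset ℕ) (k e : ℕ) : cA A k ≤ cA A (k + e) + e := by
  induction e with
  | zero => simp
  | succ e ih =>
    have := cA_succ A (k + e)
    rw [show k + (e + 1) = k + e + 1 by omega]
    split_ifs at this <;> omega

lemma cA_bound (A : Finset ℕ) (k : ℕ) (h : 0 < cA A k) : k ≤ A.sup id := by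
  unfold cA at h
  rw [Finset.card_pos] at h
  obtain ⟨l, hl⟩ := h
  simp at hl
  exact hl.2.trans (Finset.le_sup (f := id) hl.1)

/-- diagram from a set -/
def ofA (A : Finset ℕ) : YoungDiagram where
  cells := (Finset.range (A.sup id + A.card + 1) ×ˢ Finset.range (A.sup id + A.card + 1)).filter
    fun c => min c.1 c.2 < cA A (max c.1 c.2 - min c.1 c.2)
  isLowerSet := by
    rintro ⟨i, j⟩ ⟨i', j'⟩ hle h
    rw [Prod.mk_le_mk] at hle
    simp only [Finset.coe_filter, Finset.mem_product, Finset.mem_range, Set.mem_ofPred_eq] at h ⊢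
    refine ⟨by omega, ?_⟩
    have hm : min i' j' ≤ min i j := by omega
    have hM : max i' j' ≤ max i j := by omega
    have hmm : min i j ≤ max i j := by omega
    have hmm' : min i' j' ≤ max i' j' := by omega
    generalize min i' j' = m' at *
    generalize max i' j' = M' at *
    generalize min i j = m at *
    generalize max i j = M at *
    have h1 := cA_lip A (M - m) (m - m')
    have h2 := cA_anti A (show M' - m' ≤ M - m + (m - m') by omega)
    omega

lemma mem_ofA (A : Finset ℕ) (i j : ℕ) :
    (i, j) ∈ ofA A ↔ min i j < cA A (max i j - min i j) := by
  rw [← YoungDiagram.mem_cells]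
  unfold ofA
  simp only [Finset.mem_filter, Finset.mem_product, Finset.mem_range, and_iff_right_iff_imp]
  intro h
  have h1 := cA_bound A _ (by omega : 0 < cA A (max i j - min i j))
  have h2 : cA A (max i j - min i j) ≤ A.card := Finset.card_filter_le _ _
  omega

lemma ofA_sc (A : Finset ℕ) : (ofA A).transpose = ofA A := by
  ext ⟨i, j⟩
  rw [YoungDiagram.mem_cells, YoungDiagram.mem_cells, YoungDiagram.mem_transpose, Prod.swap_prod_mk,
    mem_ofA, mem_ofA, min_comm, max_comm]

lemma mem_toA (μ : YoungDiagram) (a : ℕ) :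
    a ∈ toA μ ↔ ∃ i, (i, i + a) ∈ μ ∧ (i, i + a + 1) ∉ μ := by
  unfold toA bb
  simp only [Finset.mem_image, mem_DD, YoungDiagram.mem_iff_lt_rowLen]
  constructor
  · rintro ⟨i, h1, h2⟩; exact ⟨i, by omega, by omega⟩
  · rintro ⟨i, h1, h2⟩; exact ⟨i, by omega, by omega⟩

lemma toA_ofA (A : Finset ℕ) : toA (ofA A) = A := by
  ext a
  rw [mem_toA]
  simp only [mem_ofA]
  have e1 : ∀ i, min i (i + a) = i := by intro i; omega
  have e2 : ∀ i, max i (i + a) - i = a := by intro i; omega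
  have e3 : ∀ i, min i (i + a + 1) = i := by intro i; omega
  have e4 : ∀ i, max i (i + a + 1) - i = a + 1 := by intro i; omega
  simp only [e1, e2, e3, e4]
  have := cA_succ A a
  constructor
  · rintro ⟨i, h1, h2⟩
    by_contra h
    rw [if_neg h] at this
    omega
  · intro h
    rw [if_pos h] at this
    exact ⟨cA A (a + 1), by omega, by omega⟩

lemma cA_toA (μ : YoungDiagram) (i j : ℕ) (hij : i ≤ j) : (i, j) ∈ μ ↔ i < cA (toA μ) (j - i) := by
  rw [YoungDiagram.mem_iff_lt_rowLen]
  constructor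
  · intro h
    have hD : ∀ k ∈ Finset.range (i + 1), k ∈ DD μ := by
      intro k hk
      rw [Finset.mem_range] at hk
      rw [mem_DD]
      have := μ.rowLen_anti k i (by omega)
      omega
    have : (Finset.range (i + 1)).image (bb μ) ⊆ (toA μ).filter fun l => j - i ≤ l := by
      intro l hl
      rw [Finset.mem_image] at hl
      obtain ⟨k, hk, rfl⟩ := hl
      rw [Finset.mem_filter]
      refine ⟨Finset.mem_image_of_mem _ (hD k hk), ?_⟩
      rw [Finset.mem_range] at hk
      have := μ.rowLen_anti k i (by omega)
      unfold bb
      omega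
    have h2 := Finset.card_le_card this
    rw [Finset.card_image_of_injOn, Finset.card_range] at h2
    · exact h2
    · intro a ha b hb e
      exact bb_inj μ (hD a ha) (hD b hb) e
  · intro h
    by_contra hc
    have : ((toA μ).filter fun l => j - i ≤ l) ⊆ (Finset.range i).image (bb μ) := by
      intro l hl
      unfold toA at hl
      rw [Finset.mem_filter, Finset.mem_image] at hl
      obtain ⟨⟨k, hk, rfl⟩, h3⟩ := hl
      apply Finset.mem_image_of_mem
      rw [Finset.mem_range]
      by_contra hki
      have := μ.rowLen_anti i k (by omega)
      rw [mem_DD] at hk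
      unfold bb at h3
      omega
    have h2 := (Finset.card_le_card this).trans Finset.card_image_le
    rw [Finset.card_range] at h2
    unfold cA at h
    omega

lemma ofA_toA (μ : YoungDiagram) (hμ : μ.transpose = μ) : ofA (toA μ) = μ := by
  ext ⟨i, j⟩
  rw [YoungDiagram.mem_cells, YoungDiagram.mem_cells, mem_ofA]
  rcases le_total i j with h | h
  · rw [min_eq_left h, max_eq_right h, cA_toA μ i j h]
  · rw [min_eq_right h, max_eq_left h, mem_symm hμ, cA_toA μ j i h]

/-- the bijection -/
def scEquiv : {μ : YoungDiagram // μ.transpose = μ} ≃ Finset ℕ where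
  toFun μ := toA μ.1
  invFun A := ⟨ofA A, ofA_sc A⟩
  left_inv μ := Subtype.ext (ofA_toA μ.1 μ.2)
  right_inv A := toA_ofA A

/-- summand indexed by sets -/
def trm (t' : ℕ) (y z : ℂ) (A : Finset ℕ) : PowerSeries ℂ :=
  PowerSeries.C ((-1) ^ A.card * (y ^ wA (2 * t' + 1) A * WA z (2 * t' + 1) A)) * X ^ sz A

lemma lhs_eq (t' : ℕ) (y z : ℂ) :
    ∑' μ : {μ : YoungDiagram // μ.transpose = μ},
      PowerSeries.C ((-1) ^ durfee μ.1 *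
        ∏ c ∈ μ.1.cells.filter (fun c => (2 * t' + 1) ∣ hookLen μ.1 c),
          (y - y * z * (2 * t' + 1 : ℕ) / ((hookLen μ.1 c : ℂ) * eps c))) * X ^ μ.1.card
      = ∑' A : Finset ℕ, trm t' y z A := by
  rw [← scEquiv.tsum_eq]
  apply tsum_congr
  rintro ⟨μ, hμ⟩
  change _ = trm t' y z (toA μ)
  unfold trm
  rw [hook_prod hμ, card_toA, card_sc hμ]

lemma sz_big (A : Finset ℕ) (n : ℕ) (h : sz A ≤ n) : A ⊆ Finset.range (n + 1) := by
  intro a ha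
  rw [Finset.mem_range]
  have : 2 * a + 1 ≤ sz A := by
    unfold sz
    exact Finset.single_le_sum (f := fun a => 2 * a + 1) (fun _ _ => Nat.zero_le _) ha
  omega

instance : T2Space (PowerSeries ℂ) := inferInstanceAs (T2Space ((Unit →₀ ℕ) → ℂ))

lemma coeff_tsum (t' : ℕ) (y z : ℂ) (n N : ℕ) (hN : n < N) :
    coeff n (∑' A : Finset ℕ, trm t' y z A) = coeff n (LC t' N y z) := by
  have hs : HasSum (trm t' y z) (PowerSeries.mk fun n => coeff n (LC t' (n + 1) y z)) := by
    refine (PowerSeries.WithPiTopology.hasSum_iff_hasSum_coeff (R := ℂ)).2 ?_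
    intro d
    rw [coeff_mk]
    unfold LC
    rw [map_sum]
    apply hasSum_sum_of_ne_finset_zero
    intro A hA
    unfold trm
    rw [coeff_C_mul_X_pow, if_neg]
    intro h
    apply hA
    rw [Finset.mem_powerset]
    exact sz_big A d h.ge
  rw [hs.tsum_eq, coeff_mk]
  unfold LC
  rw [map_sum, map_sum]
  apply Finset.sum_subset
  · apply Finset.powerset_mono.2
    exact Finset.range_subset_range.2 (by omega)
  · intro A _ hA
    rw [coeff_C_mul_X_pow, if_neg]
    intro h
    apply hA
    rw [Finset.mem_powerset]
    exact sz_big A n h.ge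

section ab
variable {S : Type*} [CommRing S]

lemma euler_even (x : S) (M : ℕ) : ∏ k ∈ Finset.range (2 * M), (1 - x ^ (k + 1)) =
    ∏ k ∈ Finset.range M, ((1 - x ^ (2 * k + 1)) * ((1 + x ^ (k + 1)) * (1 - x ^ (k + 1)))) := by
  induction M with
  | zero => simp
  | succ M ih =>
    rw [Finset.prod_range_succ, ← ih, show 2 * (M + 1) = 2 * M + 1 + 1 by ring,
      Finset.prod_range_succ, Finset.prod_range_succ]
    ring

lemma euler_trunc (x : S) (K M : ℕ) (hx : x ^ K = 0) (hM : K ≤ M) :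
    (∏ k ∈ Finset.range M, (1 - x ^ (2 * k + 1))) * ∏ k ∈ Finset.range K, (1 + x ^ (k + 1)) = 1 := by
  have h0 : ∀ k, K ≤ k → x ^ (k + 1) = 0 := fun k hk => by
    rw [show k + 1 = K + (k + 1 - K) by omega, pow_add, hx, zero_mul]
  have h1 : ∏ k ∈ Finset.range (2 * M), (1 - x ^ (k + 1)) = ∏ k ∈ Finset.range M, (1 - x ^ (k + 1)) := by
    symm
    apply Finset.prod_subset (Finset.range_subset_range.2 (by omega))
    intro k _ hk
    rw [Finset.mem_range] at hk
    rw [h0 k (by omega), sub_zero]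
  have h2 : ∏ k ∈ Finset.range M, (1 + x ^ (k + 1)) = ∏ k ∈ Finset.range K, (1 + x ^ (k + 1)) := by
    symm
    apply Finset.prod_subset (Finset.range_subset_range.2 (by omega))
    intro k _ hk
    rw [Finset.mem_range] at hk
    rw [h0 k (by omega), add_zero]
  have h3 := euler_even x M
  rw [h1, Finset.prod_mul_distrib, Finset.prod_mul_distrib, h2, ← mul_assoc] at h3
  have hu : IsUnit (∏ k ∈ Finset.range M, (1 - x ^ (k + 1))) := by
    rw [IsUnit.prod_iff]
    intro k _
    apply IsNilpotent.isUnit_one_sub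
    exact ⟨K, by rw [← pow_mul, mul_comm, pow_mul, hx, zero_pow (by omega)]⟩
  apply hu.mul_right_cancel
  rw [one_mul]
  exact h3.symm

variable [Algebra ℚ S]

lemma bn_one_ge (k : ℕ) : bn (1 : S) (k + 2) = 0 := by
  induction k with
  | zero => rw [bn, bn]; simp
  | succ k ih => rw [bn, ih]; simp

lemma PP_one (K : ℕ) (u : S) (hu : u ^ K = 0) (hK : 1 ≤ K) : PP K 1 u = 1 - u := by
  unfold PP
  obtain ⟨K, rfl⟩ : ∃ K', K = K' + 1 := ⟨K - 1, by omega⟩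
  cases K with
  | zero => simp at hu; simp [hu, bn]
  | succ K =>
    rw [Finset.sum_range_succ', Finset.sum_range_succ']
    simp only [bn_one_ge]
    simp [bn]
    ring

lemma PP_nat (K : ℕ) (u : S) (hu : u ^ K = 0) (hK : 1 ≤ K) (j : ℕ) :
    PP K (j : S) u = (1 - u) ^ j := by
  induction j with
  | zero => rw [Nat.cast_zero, PP_zero K hK, pow_zero]
  | succ j ih => rw [Nat.cast_succ, ← PP_mul K _ _ _ hu, ih, PP_one K u hu hK, pow_succ]

end ab

lemma WA_zero (t : ℕ) (A : Finset ℕ) : WA 0 t A = 1 := by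
  unfold WA loc Gf
  simp

lemma LC_zero (t' N : ℕ) : LC t' N 1 0 = ∏ k ∈ Finset.range N, (1 - (X : PowerSeries ℂ) ^ (2 * k + 1)) := by
  simp only [sub_eq_add_neg]
  rw [Finset.prod_one_add]
  unfold LC
  apply Finset.sum_congr rfl
  intro A _
  rw [WA_zero, Finset.prod_neg, Finset.prod_pow_eq_pow_sum]
  simp [sz]

lemma cchoose_bn (e : ℂ) (k : ℕ) : cchoose e k * (-1) ^ k = bn e k := by
  induction k with
  | zero => simp [cchoose, bn]
  | succ k ih =>
    rw [bn_succ', ← ih]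
    unfold cchoose
    rw [Finset.prod_range_succ, Nat.factorial_succ]
    have : (k : ℂ) + 1 ≠ 0 := by exact_mod_cast Nat.succ_ne_zero k
    have h2 : (k.factorial : ℂ) ≠ 0 := by exact_mod_cast k.factorial_ne_zero
    push_cast
    field_simp
    ring

lemma coeff_cpow (a e : ℂ) (m : ℕ) (hm : 1 ≤ m) (n K : ℕ) (hn : n < K) :
    coeff n (cpow (1 - PowerSeries.C a * X ^ m) e) =
      coeff n (PP K (PowerSeries.C e) (PowerSeries.C a * X ^ m)) := by
  have hz : ∀ n k, n < k → coeff n (PowerSeries.C (bn e k) * (PowerSeries.C a * X ^ m) ^ k) = 0 := by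
    intro n k hk
    rw [mul_pow, ← map_pow, ← mul_assoc, ← map_mul, ← pow_mul, coeff_C_mul_X_pow, if_neg]
    nlinarith
  have ht : ∀ k, PowerSeries.C (cchoose e k) * ((1 - PowerSeries.C a * X ^ m) - 1) ^ k =
      PowerSeries.C (bn e k) * (PowerSeries.C a * X ^ m) ^ k := by
    intro k
    rw [← cchoose_bn, sub_sub_cancel_left, neg_pow, map_mul, map_pow]
    simp
    ring
  have hs : HasSum (fun k => PowerSeries.C (bn e k) * (PowerSeries.C a * X ^ m) ^ k)
      (PowerSeries.mk fun n => coeff n (∑ k ∈ Finset.range (n + 1),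
        PowerSeries.C (bn e k) * (PowerSeries.C a * X ^ m) ^ k)) := by
    refine (PowerSeries.WithPiTopology.hasSum_iff_hasSum_coeff (R := ℂ)).2 ?_
    intro d
    rw [coeff_mk, map_sum]
    apply hasSum_sum_of_ne_finset_zero
    intro k hk
    rw [Finset.mem_range] at hk
    exact hz d k (by omega)
  unfold cpow
  simp only [ht]
  rw [hs.tsum_eq, coeff_mk]
  unfold PP
  rw [map_sum, map_sum]
  simp only [← bn_map]
  apply Finset.sum_subset (Finset.range_subset_range.2 (by omega))
  intro k _ hk
  rw [Finset.mem_range] at hk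
  exact hz n k (by omega)

lemma cpow_const (a e : ℂ) (m : ℕ) (hm : 1 ≤ m) :
    constantCoeff (cpow (1 - PowerSeries.C a * X ^ m) e) = 1 := by
  rw [← coeff_zero_eq_constantCoeff_apply, coeff_cpow a e m hm 0 1 (by omega)]
  simp [PP, bn]

/-- the factor -/
def FF (t' : ℕ) (y z : ℂ) (k : ℕ) : PowerSeries ℂ :=
      ((1 - X ^ (2 * (k + 1) * (2 * t' + 1))) ^ t' * (1 + X ^ (k + 1) : PowerSeries ℂ)⁻¹ *
        ((1 - X ^ (2 * (k + 1) * (2 * t' + 1))) *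
          (1 - X ^ ((k + 1) * (2 * t' + 1)) : PowerSeries ℂ)⁻¹) *
        (cpow (1 - PowerSeries.C (y ^ (2 * (k + 1))) * X ^ (2 * (k + 1) * (2 * t' + 1)))
            (((2 * t' + 1 : ℕ) * z ^ 2 + z - (2 * t' + 1 : ℕ) - 1) / 2) *
          (cpow (1 - PowerSeries.C (y ^ (k + 1)) * X ^ ((k + 1) * (2 * t' + 1)))
            (z - 1))⁻¹))

section
variable {Q : Type*} [CommRing Q] [Algebra ℚ Q] (mk : PowerSeries ℂ →+* Q)

lemma mk_inv (f : PowerSeries ℂ) (hf : constantCoeff f = 1) : mk f * mk f⁻¹ = 1 := by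
  rw [← map_mul, PowerSeries.mul_inv_cancel f (by rw [hf]; exact one_ne_zero), map_one]

variable (K : ℕ) (hK : 1 ≤ K) (hmk : ∀ f g : PowerSeries ℂ, X ^ K ∣ f - g → mk f = mk g)

lemma mk_cpow (hmk : ∀ f g : PowerSeries ℂ, X ^ K ∣ f - g → mk f = mk g)
    (a e : ℂ) (m : ℕ) (hm : 1 ≤ m) :
    mk (cpow (1 - PowerSeries.C a * X ^ m) e) =
      PP K (mk (PowerSeries.C e)) (mk (PowerSeries.C a * X ^ m)) := by
  rw [← PP_map]
  apply hmk
  rw [PowerSeries.X_pow_dvd_iff]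
  intro n hn
  rw [map_sub, coeff_cpow a e m hm n K hn, sub_self]

lemma mk_prod (hK : 1 ≤ K) (hmk : ∀ f g : PowerSeries ℂ, X ^ K ∣ f - g → mk f = mk g)
    (t' : ℕ) (y z : ℂ) :
    mk (LC t' (2 * K) y z) = mk (∏ k ∈ Finset.range K, FF t' y z k) := by
  have hx : mk X ^ K = 0 := by
    rw [← map_pow, ← map_zero mk]
    apply hmk
    simp
  have hxm : ∀ (a : ℂ) (m : ℕ), 1 ≤ m → (mk (PowerSeries.C a * X ^ m)) ^ K = 0 := by
    intro a m hm
    rw [map_mul, map_pow, mul_pow, ← pow_mul, mul_comm m, pow_mul, hx, zero_pow (by omega), mul_zero]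
  have h1 := hmk _ _ (LC_formula t' K (2 * K) hK le_rfl y z)
  have h2 := hmk _ _ (LC_formula t' K (2 * K) hK le_rfl 1 0)
  rw [LC_zero] at h2
  have h3 := euler_trunc (mk X) K (2 * K) hx (by omega)
  have h3' : (mk (∏ k ∈ Finset.range (2 * K), (1 - (X : PowerSeries ℂ) ^ (2 * k + 1)))) *
      ∏ k ∈ Finset.range K, mk (1 + (X : PowerSeries ℂ) ^ (k + 1)) = 1 := by
    rw [← h3]; simp [map_prod]
  have h4 : ∏ k ∈ Finset.range K, mk (1 + (X : PowerSeries ℂ) ^ (k + 1))⁻¹ =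
      mk (∏ k ∈ Finset.range (2 * K), (1 - (X : PowerSeries ℂ) ^ (2 * k + 1))) := by
    have : (∏ k ∈ Finset.range K, mk (1 + (X : PowerSeries ℂ) ^ (k + 1))) *
        ∏ k ∈ Finset.range K, mk (1 + (X : PowerSeries ℂ) ^ (k + 1))⁻¹ = 1 := by
      rw [← Finset.prod_mul_distrib]
      apply Finset.prod_eq_one
      intro k _
      apply mk_inv
      simp
    linear_combination (-∏ k ∈ Finset.range K, mk (1 + (X : PowerSeries ℂ) ^ (k + 1))⁻¹) * h3' +
      mk (∏ k ∈ Finset.range (2 * K), (1 - (X : PowerSeries ℂ) ^ (2 * k + 1))) * this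
  have h5 : ∀ (y z : ℂ), mk (RC t' K z (PowerSeries.C y * X ^ (2 * t' + 1))) =
      ∏ k ∈ Finset.range K,
        (PP K (mk (PowerSeries.C (((2 * t' + 1 : ℕ) * z ^ 2 + z - (2 * t' + 1 : ℕ) - 1) / 2)))
          (mk (PowerSeries.C (y ^ (2 * (k + 1))) * X ^ (2 * (k + 1) * (2 * t' + 1)))) *
        PP K (mk (PowerSeries.C (1 - z)))
          (mk (PowerSeries.C (y ^ (k + 1)) * X ^ ((k + 1) * (2 * t' + 1))))) := by
    intro y z
    unfold RC
    rw [RR_map]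
    unfold RR
    apply Finset.prod_congr rfl
    intro k _
    rw [← map_pow, ← map_pow, mul_pow, mul_pow, ← pow_mul, ← pow_mul, ← map_pow, ← map_pow]
    congr 2
    · congr 2
      unfold Ez
      simp
      ring
    · rw [mul_comm (2 * t' + 1)]
    · rw [mul_comm (2 * t' + 1)]
  have h6 : ∀ k, (PP K (mk (PowerSeries.C (((2 * t' + 1 : ℕ) * (0 : ℂ) ^ 2 + 0 - (2 * t' + 1 : ℕ) - 1) / 2)))
          (mk (PowerSeries.C ((1 : ℂ) ^ (2 * (k + 1))) * X ^ (2 * (k + 1) * (2 * t' + 1)))) *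
        PP K (mk (PowerSeries.C (1 - (0 : ℂ))))
          (mk (PowerSeries.C ((1 : ℂ) ^ (k + 1)) * X ^ ((k + 1) * (2 * t' + 1))))) *
      mk ((1 - X ^ (2 * (k + 1) * (2 * t' + 1))) ^ t' * ((1 - X ^ (2 * (k + 1) * (2 * t' + 1))) *
          (1 - X ^ ((k + 1) * (2 * t' + 1)) : PowerSeries ℂ)⁻¹)) = 1 := by
    intro k
    have e0 : (((2 * t' + 1 : ℕ) * (0 : ℂ) ^ 2 + 0 - (2 * t' + 1 : ℕ) - 1) / 2) = -((t' + 1 : ℕ) : ℂ) := by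
      push_cast; ring
    have hu1 := hxm 1 (2 * (k + 1) * (2 * t' + 1)) (by nlinarith)
    have hu2 := hxm 1 ((k + 1) * (2 * t' + 1)) (by nlinarith)
    rw [e0, one_pow, one_pow, sub_zero, map_one, map_one, one_mul, one_mul]
    rw [map_one, one_mul] at hu1 hu2
    rw [map_neg, map_neg, map_natCast, map_natCast, PP_one K _ hu2 hK]
    have a1 : PP K (-((t' + 1 : ℕ) : Q)) (mk (X ^ (2 * (k + 1) * (2 * t' + 1)))) *
        (1 - mk (X ^ (2 * (k + 1) * (2 * t' + 1)))) ^ (t' + 1) = 1 := by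
      rw [← PP_nat K _ hu1 hK, PP_mul K _ _ _ hu1, neg_add_cancel, PP_zero K hK]
    have a2 : (1 - mk (X ^ ((k + 1) * (2 * t' + 1)))) *
        mk (1 - X ^ ((k + 1) * (2 * t' + 1)) : PowerSeries ℂ)⁻¹ = 1 := by
      have := mk_inv mk (1 - X ^ ((k + 1) * (2 * t' + 1)) : PowerSeries ℂ) (by simp)
      rwa [map_sub, map_one] at this
    rw [map_mul, map_mul, map_pow mk (1 - _), map_sub mk 1 (X ^ (2 * (k + 1) * (2 * t' + 1))), map_one]
    rw [pow_succ] at a1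
    generalize mk (1 - X ^ ((k + 1) * (2 * t' + 1)) : PowerSeries ℂ)⁻¹ = W at *
    generalize mk (X ^ ((k + 1) * (2 * t' + 1))) = V at *
    generalize mk (X ^ (2 * (k + 1) * (2 * t' + 1))) = U at *
    linear_combination (1 - V) * W * a1 + a2
  have h7 : ∀ k, mk (FF t' y z k) = mk (1 + (X : PowerSeries ℂ) ^ (k + 1))⁻¹ *
      mk ((1 - X ^ (2 * (k + 1) * (2 * t' + 1))) ^ t' * ((1 - X ^ (2 * (k + 1) * (2 * t' + 1))) *
          (1 - X ^ ((k + 1) * (2 * t' + 1)) : PowerSeries ℂ)⁻¹)) *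
      (PP K (mk (PowerSeries.C (((2 * t' + 1 : ℕ) * z ^ 2 + z - (2 * t' + 1 : ℕ) - 1) / 2)))
          (mk (PowerSeries.C (y ^ (2 * (k + 1))) * X ^ (2 * (k + 1) * (2 * t' + 1)))) *
        PP K (mk (PowerSeries.C (1 - z)))
          (mk (PowerSeries.C (y ^ (k + 1)) * X ^ ((k + 1) * (2 * t' + 1))))) := by
    intro k
    have hm1 : 1 ≤ 2 * (k + 1) * (2 * t' + 1) := by nlinarith
    have hm2 : 1 ≤ (k + 1) * (2 * t' + 1) := by nlinarith
    have b1 := mk_inv mk _ (cpow_const (y ^ (k + 1)) (z - 1) _ hm2)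
    rw [mk_cpow mk K hmk _ _ _ hm2] at b1
    have b2 : PP K (mk (PowerSeries.C (z - 1)))
          (mk (PowerSeries.C (y ^ (k + 1)) * X ^ ((k + 1) * (2 * t' + 1)))) *
        PP K (mk (PowerSeries.C (1 - z)))
          (mk (PowerSeries.C (y ^ (k + 1)) * X ^ ((k + 1) * (2 * t' + 1)))) = 1 := by
      rw [PP_mul K _ _ _ (hxm _ _ hm2), ← map_add, ← map_add, show z - 1 + (1 - z) = 0 by ring,
        map_zero, map_zero, PP_zero K hK]
    have b3 : mk (cpow (1 - PowerSeries.C (y ^ (k + 1)) * X ^ ((k + 1) * (2 * t' + 1)))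
            (z - 1))⁻¹ = PP K (mk (PowerSeries.C (1 - z)))
          (mk (PowerSeries.C (y ^ (k + 1)) * X ^ ((k + 1) * (2 * t' + 1)))) := by
      rw [← mul_one (mk _), ← b2, ← mul_assoc, mul_comm (mk _), b1, one_mul]
    unfold FF
    rw [← mk_cpow mk K hmk _ _ _ hm1, ← b3]
    simp only [← map_mul]
    congr 1
    ring
  rw [map_prod, Finset.prod_congr rfl (fun k _ => h7 k), Finset.prod_mul_distrib,
    Finset.prod_mul_distrib, h4, h2, map_mul, h5 1 0, h1, map_mul, h5 y z]
  congr 1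
  rw [mul_assoc, ← Finset.prod_mul_distrib, Finset.prod_congr rfl (fun k _ => h6 k),
    Finset.prod_const_one, mul_one]

lemma PP_at_zero (K : ℕ) (hK : 1 ≤ K) (e : Q) : PP K e 0 = 1 := by
  unfold PP
  rw [Finset.sum_eq_single 0]
  · simp [bn]
  · intro b _ hb
    simp [hb]
  · intro h
    simp at h
    omega

lemma mk_FF (t' : ℕ) (y z : ℂ) (k : ℕ)
    (hmk : ∀ f g : PowerSeries ℂ, X ^ (k + 1) ∣ f - g → mk f = mk g) :
    mk (FF t' y z k) = mk 1 := by
  have hx : ∀ m, k + 1 ≤ m → mk (X ^ m) = 0 := by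
    intro m hm
    rw [← map_zero mk]
    apply hmk
    rw [sub_zero]
    exact pow_dvd_pow _ hm
  have hm1 : k + 1 ≤ 2 * (k + 1) * (2 * t' + 1) := by nlinarith
  have hm2 : k + 1 ≤ (k + 1) * (2 * t' + 1) := by nlinarith
  have i1 := mk_inv mk (1 + X ^ (k + 1)) (by simp)
  have i2 := mk_inv mk (1 - X ^ ((k + 1) * (2 * t' + 1))) (by simp)
  have i3 := mk_inv mk _ (cpow_const (y ^ (k + 1)) (z - 1) _ (by omega : 1 ≤ (k + 1) * (2 * t' + 1)))
  rw [map_add, map_one, hx _ le_rfl, add_zero, one_mul] at i1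
  rw [map_sub, map_one, hx _ hm2, sub_zero, one_mul] at i2
  rw [mk_cpow mk (k + 1) hmk _ _ _ (by omega), map_mul, hx _ hm2, mul_zero,
    PP_at_zero _ (by omega), one_mul] at i3
  unfold FF
  simp only [map_mul]
  rw [i1, i2, i3, mk_cpow mk (k + 1) hmk _ _ _ (by omega), map_mul, hx _ hm1, mul_zero,
    PP_at_zero _ (by omega), map_pow, map_sub, hx _ hm1]
  simp

end

lemma quot_hmk (K : ℕ) (f g : PowerSeries ℂ) :
    Ideal.Quotient.mk (Ideal.span {(X : PowerSeries ℂ) ^ K}) f = Ideal.Quotient.mk _ g ↔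
      X ^ K ∣ f - g := by
  rw [Ideal.Quotient.mk_eq_mk_iff_sub_mem, Ideal.mem_span_singleton]

lemma FF_one (t' : ℕ) (y z : ℂ) (k : ℕ) : (X : PowerSeries ℂ) ^ (k + 1) ∣ FF t' y z k - 1 :=
  (quot_hmk _ _ _).1 (mk_FF (Ideal.Quotient.mk (Ideal.span {(X : PowerSeries ℂ) ^ (k + 1)})) t' y z k
    (fun f g h => (quot_hmk _ _ _).2 h))

lemma LC_FF (t' : ℕ) (y z : ℂ) (K : ℕ) (hK : 1 ≤ K) :
    (X : PowerSeries ℂ) ^ K ∣ LC t' (2 * K) y z - ∏ k ∈ Finset.range K, FF t' y z k :=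
  (quot_hmk _ _ _).1 (mk_prod (Ideal.Quotient.mk (Ideal.span {(X : PowerSeries ℂ) ^ K})) K hK
    (fun f g h => (quot_hmk _ _ _).2 h) t' y z)

lemma FF_prod (t' : ℕ) (y z : ℂ) (K : ℕ) (s : Finset ℕ) (hs : Finset.range K ⊆ s) :
    (X : PowerSeries ℂ) ^ K ∣ ∏ k ∈ s, FF t' y z k - ∏ k ∈ Finset.range K, FF t' y z k := by
  rw [← quot_hmk, map_prod, map_prod]
  symm
  apply Finset.prod_subset hs
  intro k _ hk
  rw [Finset.mem_range] at hk
  rw [← map_one (Ideal.Quotient.mk (Ideal.span {(X : PowerSeries ℂ) ^ K})), quot_hmk]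
  exact (pow_dvd_pow _ (by omega)).trans (FF_one t' y z k)

lemma final (t' : ℕ) (y z : ℂ) :
    HasProd (FF t' y z) (∑' A : Finset ℕ, trm t' y z A) := by
  unfold HasProd
  refine (PowerSeries.WithPiTopology.tendsto_iff_coeff_tendsto (R := ℂ) _ _ _).2 ?_
  intro d
  apply tendsto_const_nhds.congr'
  rw [SummationFilter.unconditional_filter, Filter.EventuallyEq, Filter.eventually_atTop]
  refine ⟨Finset.range (d + 1), fun s hs => ?_⟩
  have h1 := LC_FF t' y z (d + 1) (by omega)
  have h2 := FF_prod t' y z (d + 1) s hs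
  rw [PowerSeries.X_pow_dvd_iff] at h1 h2
  have h3 := h1 d (by omega)
  have h4 := h2 d (by omega)
  rw [map_sub, sub_eq_zero] at h3 h4
  rw [coeff_tsum t' y z d (2 * (d + 1)) (by omega), h3, h4]

theorem main_thm (t' : ℕ) (y z : ℂ) :
    ∑' μ : {μ : YoungDiagram // μ.transpose = μ},
      PowerSeries.C ((-1) ^ durfee μ.1 *
        ∏ c ∈ μ.1.cells.filter (fun c => (2 * t' + 1) ∣ hookLen μ.1 c),
          (y - y * z * (2 * t' + 1 : ℕ) / ((hookLen μ.1 c : ℂ) * eps c))) * X ^ μ.1.card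
      = ∏' k : ℕ, FF t' y z k := by
  rw [lhs_eq, (final t' y z).tprod_eq]

theorem genscpair_t_odd (t' : ℕ) (y z : ℂ) :
    ∑' μ : {μ : YoungDiagram // μ.transpose = μ},
      PowerSeries.C ((-1) ^ durfee μ.1 *
        ∏ c ∈ μ.1.cells.filter (fun c => (2 * t' + 1) ∣ hookLen μ.1 c),
          (y - y * z * (2 * t' + 1 : ℕ) / ((hookLen μ.1 c : ℂ) * eps c))) * X ^ μ.1.card
      =
    ∏' k : ℕ,
      ((1 - X ^ (2 * (k + 1) * (2 * t' + 1))) ^ t' * (1 + X ^ (k + 1) : PowerSeries ℂ)⁻¹ *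
        ((1 - X ^ (2 * (k + 1) * (2 * t' + 1))) *
          (1 - X ^ ((k + 1) * (2 * t' + 1)) : PowerSeries ℂ)⁻¹) *
        (cpow (1 - PowerSeries.C (y ^ (2 * (k + 1))) * X ^ (2 * (k + 1) * (2 * t' + 1)))
            (((2 * t' + 1 : ℕ) * z ^ 2 + z - (2 * t' + 1 : ℕ) - 1) / 2) *
          (cpow (1 - PowerSeries.C (y ^ (k + 1)) * X ^ ((k + 1) * (2 * t' + 1)))
            (z - 1))⁻¹)) := by
  exact main_thm t' y z
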